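/- Let τ ∈ ℂ be a proper root of unity, with τ² a primitive ℓ-th root of unity (ℓ ≥ 2). Then T_{ℓ−1}(τ) contains a (unique) Jones–Wenzl idempotent p_{ℓ−1}, and the ideal of negligible morphisms in TL(τ) is equal to the ideal generated by p_{ℓ−1}. -/

import Mathlib

/-!
Common definitions: the Temperley–Lieb category over a field `K` with loop
parameter `d`.

An `(m,n)`-Temperley–Lieb diagram is a noncrossing perfect matching of `m`
marked points on the top edge and `n` marked points on the bottom edge of a
rectangle.  We encode it as a fixed-point-free involution of
`Fin m ⊕ Fin n` (`Sum.inl i` is the `i`-th top point, `Sum.inr j` the `j`-th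
bottom point) which is noncrossing with respect to the boundary order of the
points (top points from left to right, then bottom points from right to left).
-/

open scoped Classical

namespace TL

/-- The position of a marked point in the linear boundary order of the
rectangle: top points `0, …, m-1` from left to right, then bottom points
from right to left. -/
def bIdx (m n : ℕ) : Fin m ⊕ Fin n → ℕ
  | Sum.inl i => (i : ℕ)
  | Sum.inr j => m + (n - 1 - (j : ℕ))

/-- An `(m,n)`-Temperley–Lieb diagram: a noncrossing perfect matching
(= fixed-point-free involution) of the `m` top points and `n` bottom points. -/
structure Diagram (m n : ℕ) where
  pair : Fin m ⊕ Fin n → Fin m ⊕ Fin n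
  involutive : Function.Involutive pair
  fixedPointFree : ∀ x, pair x ≠ x
  noncrossing : ∀ x y, ¬ (bIdx m n x < bIdx m n y ∧ bIdx m n y < bIdx m n (pair x) ∧
      bIdx m n (pair x) < bIdx m n (pair y))

noncomputable instance (m n : ℕ) : Fintype (Diagram m n) :=
  Fintype.ofInjective (fun D => D.pair)
    (fun a b h => by cases a; cases b; simpa using h)

/-- `Hom K m n` is the `K`-vector space of morphisms from `m` to `n`:
the free vector space on the set of `(m,n)`-TL diagrams, realized as the
space of `K`-valued functions on the (finite) set of diagrams. -/
abbrev Hom (K : Type) [Field K] (m n : ℕ) : Type := Diagram m n → K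

variable {K : Type} [Field K]

/-- The basis vector of `Hom K m n` corresponding to a single diagram. -/
noncomputable def single {m n : ℕ} (p : Diagram m n) : Hom K m n :=
  fun c => if c = p then 1 else 0

/-! ### Composition -/

/-- The marked points of the picture obtained by stacking an `(l,m)`-diagram
on top of an `(m,n)`-diagram: `l` top points, `m` middle points, `n` bottom
points. -/
abbrev Pt (l m n : ℕ) := Fin l ⊕ (Fin m ⊕ Fin n)

/-- One strand of the stacked picture: either a strand of the top diagram `a`
(on the `l` top and `m` middle points) or a strand of the bottom diagram `b`
(on the `m` middle and `n` bottom points). -/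
def Step {l m n : ℕ} (a : Diagram l m) (b : Diagram m n) : Pt l m n → Pt l m n → Prop :=
  fun x y =>
    (∃ u : Fin l ⊕ Fin m, Sum.map id Sum.inl u = x ∧ Sum.map id Sum.inl (a.pair u) = y) ∨
    (∃ u : Fin m ⊕ Fin n, Sum.inr u = x ∧ Sum.inr (b.pair u) = y)

/-- Connectivity in the stacked picture: two marked points are connected if
they are joined by a path of strands. -/
def Conn {l m n : ℕ} (a : Diagram l m) (b : Diagram m n) : Pt l m n → Pt l m n → Prop :=
  Relation.EqvGen (Step a b)

/-- The points of the middle layer whose connected component stays entirely in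
the middle layer; these components are exactly the closed loops produced when
stacking. -/
def ClosedMid {l m n : ℕ} (a : Diagram l m) (b : Diagram m n) : Set (Pt l m n) :=
  {x | (∃ j : Fin m, x = Sum.inr (Sum.inl j)) ∧
    ∀ y, Conn a b x y → ∃ j : Fin m, y = Sum.inr (Sum.inl j)}

/-- The number of closed loops produced when stacking `a` on top of `b`:
the number of connected components consisting entirely of middle points. -/
noncomputable def numLoops {l m n : ℕ} (a : Diagram l m) (b : Diagram m n) : ℕ :=
  Nat.card (Quotient (⟨fun x y : ClosedMid a b => Conn a b x.1 y.1,
    ⟨fun _ => Relation.EqvGen.refl _, fun h => Relation.EqvGen.symm _ _ h,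
      fun h h' => Relation.EqvGen.trans _ _ _ h h'⟩⟩ : Setoid (ClosedMid a b)))

/-- Composition of two diagrams `b ∘ a` (stack `a` on top of `b`, delete the
`r` closed loops, multiply by `d ^ r`), expressed as an element of
`Hom K l n`: the result is `d ^ r` times the unique `(l,n)`-diagram inducing
the same pairing of the outer points as the connectivity of the stacked
picture. -/
noncomputable def compD (d : K) {l m n : ℕ} (b : Diagram m n) (a : Diagram l m) :
    Hom K l n :=
  fun c =>
    if ∀ x : Fin l ⊕ Fin n,
        Conn a b (Sum.map id Sum.inr x) (Sum.map id Sum.inr (c.pair x))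
    then d ^ numLoops a b else 0

/-- Composition `b ∘ a : Hom K l n` of `b : Hom K m n` with `a : Hom K l m`
(bilinear extension of composition of diagrams). -/
noncomputable def comp (d : K) {l m n : ℕ} (b : Hom K m n) (a : Hom K l m) :
    Hom K l n :=
  fun c => ∑ p : Diagram m n, ∑ q : Diagram l m, b p * a q * compD d p q c

/-! ### Tensor product -/

/-- Relabelling of the marked points of a horizontal juxtaposition of an
`(m,n)`-diagram (placed on the left) and an `(m',n')`-diagram (on the right). -/
def tEquiv (m n m' n' : ℕ) :
    (Fin (m + m') ⊕ Fin (n + n')) ≃ ((Fin m ⊕ Fin n) ⊕ (Fin m' ⊕ Fin n')) :=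
  (Equiv.sumCongr finSumFinEquiv.symm finSumFinEquiv.symm).trans
    (Equiv.sumSumSumComm _ _ _ _)

/-- The pairing of the horizontal juxtaposition of two diagrams. -/
def tensorPair {m n m' n' : ℕ} (a : Diagram m n) (b : Diagram m' n') :
    Fin (m + m') ⊕ Fin (n + n') → Fin (m + m') ⊕ Fin (n + n') :=
  fun x => (tEquiv m n m' n').symm (Sum.map a.pair b.pair (tEquiv m n m' n' x))

/-- The tensor product (horizontal juxtaposition) of two diagrams, as an
element of `Hom K (m+m') (n+n')`: the basis vector of the unique diagram whose
pairing is the juxtaposed pairing. -/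
noncomputable def tensorD {m n m' n' : ℕ} (a : Diagram m n) (b : Diagram m' n') :
    Hom K (m + m') (n + n') :=
  fun c => if c.pair = tensorPair a b then 1 else 0

/-- The tensor product of morphisms (bilinear extension of horizontal
juxtaposition of diagrams). -/
noncomputable def tensor {m n m' n' : ℕ} (x : Hom K m n) (y : Hom K m' n') :
    Hom K (m + m') (n + n') :=
  fun c => ∑ p : Diagram m n, ∑ q : Diagram m' n', x p * y q * tensorD p q c

/-! ### Identity, cup and cap -/

/-- The identity diagram `1_n`: `n` vertical strands. -/
def idD (n : ℕ) : Diagram n n where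
  pair := Sum.elim Sum.inr Sum.inl
  involutive := by rintro (i | i) <;> rfl
  fixedPointFree := by rintro (i | i) <;> simp
  noncrossing := by
    rintro (i | i) (j | j) <;>
      · simp only [Sum.elim_inl, Sum.elim_inr, bIdx]
        have hi := i.isLt; have hj := j.isLt; omega

/-- The identity morphism `1_n ∈ T_n`. -/
noncomputable def idHom (K : Type) [Field K] (n : ℕ) : Hom K n n :=
  fun c => if c = idD n then 1 else 0

/-- The cap `∩`: the unique `(0,2)`-TL diagram. -/
def capD : Diagram 0 2 where
  pair := fun x => match x with
    | Sum.inl i => i.elim0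
    | Sum.inr j => Sum.inr ⟨1 - (j : ℕ), by omega⟩
  involutive := by intro x; revert x; decide
  fixedPointFree := by decide
  noncrossing := by decide

/-- The cup `∪`: the unique `(2,0)`-TL diagram. -/
def cupD : Diagram 2 0 where
  pair := fun x => match x with
    | Sum.inl j => Sum.inl ⟨1 - (j : ℕ), by omega⟩
    | Sum.inr i => i.elim0
  involutive := by intro x; revert x; decide
  fixedPointFree := by decide
  noncrossing := by decide

/-- The cap `∩` as a morphism in `Hom K 0 2`. -/
noncomputable def capHom (K : Type) [Field K] : Hom K 0 2 :=
  fun c => if c = capD then 1 else 0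

/-- The cup `∪` as a morphism in `Hom K 2 0`. -/
noncomputable def cupHom (K : Type) [Field K] : Hom K 2 0 :=
  fun c => if c = cupD then 1 else 0

/-! ### The Markov trace -/

/-- The strands of the picture obtained from an `(n,n)`-diagram `p` by closing
it up: joining, for each `i`, the `i`-th top point to the `i`-th bottom point
(by nested arcs passing to the right of the rectangle). -/
def closeStep {n : ℕ} (p : Diagram n n) : (Fin n ⊕ Fin n) → (Fin n ⊕ Fin n) → Prop :=
  fun x y => p.pair x = y ∨ Sum.elim Sum.inr Sum.inl x = y

/-- The number `c(p)` of closed loops of the closure of an `(n,n)`-diagram. -/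
noncomputable def trLoops {n : ℕ} (p : Diagram n n) : ℕ :=
  Nat.card (Quotient (Relation.EqvGen.setoid (closeStep p)))

/-- The Markov trace `Tr_n : T_n → K`, sending a diagram `p` to
`d ^ c(p)`. -/
noncomputable def Tr (d : K) {n : ℕ} (x : Hom K n n) : K :=
  ∑ p : Diagram n n, x p * d ^ trLoops p

/-! ### Conditional expectations -/

/-- The conditional expectation `ε_n : T_{n+1} → T_n`,
`a ↦ (1_n ⊗ ∪) ∘ (a ⊗ 1_1) ∘ (1_n ⊗ ∩)` (closing up the last strand). -/
noncomputable def eps (d : K) (n : ℕ) (a : Hom K (n + 1) (n + 1)) : Hom K n n :=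
  let u : Hom K n (n + 2) := tensor (idHom K n) (capHom K)
  let v : Hom K (n + 2) (n + 2) := @tensor K _ (n + 1) (n + 1) 1 1 a (idHom K 1)
  let w : Hom K (n + 2) n := tensor (idHom K n) (cupHom K)
  comp d w (comp d v u)

/-- The iterated conditional expectation `ε_{n,n+m} = ε_n ∘ ε_{n+1} ∘ ⋯ ∘ ε_{n+m-1} :
T_{n+m} → T_n`. -/
noncomputable def epsIter (d : K) (n : ℕ) : (m : ℕ) → Hom K (n + m) (n + m) → Hom K n n
  | 0, a => a
  | m + 1, a => epsIter d n m (eps d (n + m) a)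

/-! ### Tensor powers of cup and cap -/

/-- `∩^{⊗k} ∈ Hom(0, 2k)`. -/
noncomputable def capPow (K : Type) [Field K] : (k : ℕ) → Hom K 0 (2 * k)
  | 0 => idHom K 0
  | k + 1 => tensor (capPow K k) (capHom K)

/-- `∪^{⊗k} ∈ Hom(2k, 0)`. -/
noncomputable def cupPow (K : Type) [Field K] : (k : ℕ) → Hom K (2 * k) 0
  | 0 => idHom K 0
  | k + 1 => tensor (cupPow K k) (cupHom K)

/-! ### Ideals -/

/-- An ideal of the Temperley–Lieb category over `(K, d)`: a family of vector
subspaces `J m n ⊆ Hom K m n` closed under composition with arbitrary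
morphisms on either side and under tensor product with arbitrary morphisms on
either side. -/
structure IsIdeal (d : K) (J : ∀ m n : ℕ, Set (Hom K m n)) : Prop where
  zero_mem : ∀ m n : ℕ, (0 : Hom K m n) ∈ J m n
  add_mem : ∀ (m n : ℕ), ∀ x ∈ J m n, ∀ y ∈ J m n, x + y ∈ J m n
  smul_mem : ∀ (m n : ℕ) (c : K), ∀ x ∈ J m n, c • x ∈ J m n
  comp_mem_left : ∀ {l m n : ℕ} (b : Hom K m n) (a : Hom K l m),
    a ∈ J l m → comp d b a ∈ J l n
  comp_mem_right : ∀ {l m n : ℕ} (b : Hom K m n) (a : Hom K l m),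
    b ∈ J m n → comp d b a ∈ J l n
  tensor_mem_left : ∀ {m n m' n' : ℕ} (x : Hom K m n) (y : Hom K m' n'),
    x ∈ J m n → tensor x y ∈ J (m + m') (n + n')
  tensor_mem_right : ∀ {m n m' n' : ℕ} (x : Hom K m n) (y : Hom K m' n'),
    y ∈ J m' n' → tensor x y ∈ J (m + m') (n + n')

/-- An ideal is nonzero if some `J m n` contains a nonzero morphism. -/
def IdealNonzero (J : ∀ m n : ℕ, Set (Hom K m n)) : Prop :=
  ∃ (m n : ℕ) (x : Hom K m n), x ∈ J m n ∧ x ≠ 0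

/-- An ideal is proper if it does not contain all morphisms. -/
def IdealProper (J : ∀ m n : ℕ, Set (Hom K m n)) : Prop :=
  ∃ m n : ℕ, J m n ≠ Set.univ

/-- The negligible morphisms: `a ∈ Hom(m,n)` with `Tr_m (b ∘ a) = 0` for all
`b ∈ Hom(n,m)`. -/
def Negl (d : K) (m n : ℕ) : Set (Hom K m n) :=
  {a | ∀ b : Hom K n m, Tr d (comp d b a) = 0}

/-- The ideal generated by a morphism `x ∈ Hom K a b`: the smallest ideal
containing `x`, i.e. the intersection of all ideals containing `x`. -/
def genIdeal (d : K) {a b : ℕ} (x : Hom K a b) (m n : ℕ) : Set (Hom K m n) :=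
  {y | ∀ J : ∀ m' n' : ℕ, Set (Hom K m' n'), IsIdeal d J → x ∈ J a b → y ∈ J m n}

/-! ### Jones–Wenzl idempotents -/

/-- The diagram `E_i ∈ T_n` (here `i` is 0-indexed, `i + 1 < n`): it joins the
`i`-th and `(i+1)`-st top points, the `i`-th and `(i+1)`-st bottom points, and
joins the `j`-th top point vertically to the `j`-th bottom point for all other
`j`; encoded as a pairing function. -/
def eiPair (n i : ℕ) : Fin n ⊕ Fin n → Fin n ⊕ Fin n
  | Sum.inl j =>
      if (j : ℕ) = i then
        Sum.inl ⟨((j : ℕ) + 1) % n, Nat.mod_lt _ (Nat.lt_of_le_of_lt (Nat.zero_le _) j.isLt)⟩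
      else if (j : ℕ) = i + 1 then
        Sum.inl ⟨(j : ℕ) - 1, Nat.lt_of_le_of_lt (Nat.sub_le _ _) j.isLt⟩
      else Sum.inr j
  | Sum.inr j =>
      if (j : ℕ) = i then
        Sum.inr ⟨((j : ℕ) + 1) % n, Nat.mod_lt _ (Nat.lt_of_le_of_lt (Nat.zero_le _) j.isLt)⟩
      else if (j : ℕ) = i + 1 then
        Sum.inr ⟨(j : ℕ) - 1, Nat.lt_of_le_of_lt (Nat.sub_le _ _) j.isLt⟩
      else Sum.inl j

/-- The morphism `E_i ∈ T_n` (0-indexed `i`). -/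
noncomputable def EHom (K : Type) [Field K] (n i : ℕ) : Hom K n n :=
  fun c => if c.pair = eiPair n i then 1 else 0

/-- A Jones–Wenzl idempotent in `T_n`: a nonzero idempotent `p` with
`E_i ∘ p = p ∘ E_i = 0` for all `i` (1-indexed `1 ≤ i ≤ n-1`; here `i` is
0-indexed, so `i + 2 ≤ n`). -/
def IsJonesWenzl (d : K) (n : ℕ) (p : Hom K n n) : Prop :=
  p ≠ 0 ∧ comp d p p = p ∧
    ∀ i : ℕ, i + 2 ≤ n → comp d (EHom K n i) p = 0 ∧ comp d p (EHom K n i) = 0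

/-- The quantum integers `[k] ∈ K`: `[0] = 0`, `[1] = 1`,
`[k+1] = d·[k] − [k−1]`. -/
def qInt (d : K) : ℕ → K
  | 0 => 0
  | 1 => 1
  | k + 2 => d * qInt d (k + 1) - qInt d k

/-! ### Contraction of noncrossing matchings -/

/-- `π` restricts to a noncrossing perfect matching of `S`, where the points are ordered
by `idx`. -/
def IsNC {α : Type} (idx : α → ℕ) (S : Set α) (π : α → α) : Prop :=
  ∀ x ∈ S, π x ∈ S ∧ π (π x) = x ∧ π x ≠ x ∧
    ∀ y ∈ S, ¬ (idx x < idx y ∧ idx y < idx (π x) ∧ idx (π x) < idx (π y))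

/-- The chord joining `i` and `j` does not separate the points of `S`. -/
def NonSep {α : Type} (idx : α → ℕ) (S : Set α) (i j : α) : Prop :=
  idx i < idx j ∧ ((∀ x ∈ S, ¬ (idx i < idx x ∧ idx x < idx j)) ∨
    ∀ x ∈ S, idx i ≤ idx x ∧ idx x ≤ idx j)

/-- Joining `i` to `j` in the matching `π` and forgetting them. -/
noncomputable def contractPair {α : Type} (π : α → α) (i j : α) : α → α := fun x =>
  if π x = i then π j else if π x = j then π i else π x

theorem cross_aux (X I J Z Y W : ℕ)
  (h1 : ¬ (X < Y ∧ Y < I ∧ I < W)) (h2 : ¬ (J < Y ∧ Y < Z ∧ Z < W)) (h3 : ¬ (Y < Z ∧ Z < W ∧ W < J))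
  (h : X < Y ∧ Y < Z ∧ Z < W) (hne : I ≠ Y ∧ I ≠ W ∧ J ≠ Y ∧ J ≠ W)
  (ha : (¬ (I < Y ∧ Y < J) ∧ ¬ (I < W ∧ W < J) ∧ ¬ (J < Y ∧ Y < I) ∧ ¬ (J < W ∧ W < I)) ∨
   ((I ≤ Y ∧ Y ≤ J) ∧ (I ≤ W ∧ W ≤ J)) ∨ ((J ≤ Y ∧ Y ≤ I) ∧ (J ≤ W ∧ W ≤ I))) : False := by omega
theorem cross_aux' (X I J Z Y W : ℕ)
  (h1 : ¬ (X < Y ∧ Y < Z ∧ Z < I)) (h2 : ¬ (I < X ∧ X < Y ∧ Y < Z)) (h3 : ¬ (X < J ∧ J < Z ∧ Z < W))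
  (h : X < Y ∧ Y < Z ∧ Z < W) (hne : I ≠ X ∧ I ≠ Z ∧ J ≠ X ∧ J ≠ Z)
  (ha : (¬ (I < X ∧ X < J) ∧ ¬ (I < Z ∧ Z < J) ∧ ¬ (J < X ∧ X < I) ∧ ¬ (J < Z ∧ Z < I)) ∨
   ((I ≤ X ∧ X ≤ J) ∧ (I ≤ Z ∧ Z ≤ J)) ∨ ((J ≤ X ∧ X ≤ I) ∧ (J ≤ Z ∧ Z ≤ I))) : False := by omega

theorem IsNC.contract {α : Type} {idx : α → ℕ} (hidx : Function.Injective idx) {S : Set α}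
    {π : α → α} (h : IsNC idx S π) {i j : α} (hi : i ∈ S) (hj : j ∈ S)
    (hs : NonSep idx S i j) : IsNC idx (S \ {i, j}) (contractPair π i j) := by
  have key : ∀ x ∈ S \ {i, j}, contractPair π i j x ∈ S \ {i, j} ∧
      contractPair π i j (contractPair π i j x) = x ∧ contractPair π i j x ≠ x := by
    intro x hx
    have h1 := h x hx.1
    have h2 := h i hi
    have h3 := h j hj
    have hij : i ≠ j := fun e => by have := hs.1; simp [e] at this
    simp only [Set.mem_sdiff, Set.mem_insert_iff, Set.mem_singleton_iff, contractPair] at *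
    grind
  have hij : i ≠ j := fun e => by have := hs.1; simp [e] at this
  have ncr : ∀ a ∈ S, ∀ b ∈ S, ¬ (idx a < idx b ∧ idx b < idx (π a) ∧ idx (π a) < idx (π b)) :=
    fun a ha => (h a ha).2.2.2
  have hmem : ∀ a ∈ S, π a ∈ S := fun a ha => (h a ha).1
  have hinv : ∀ a ∈ S, π (π a) = a := fun a ha => (h a ha).2.1
  have hsep : ∀ y ∈ S, ∀ w ∈ S,
      (¬ (idx i < idx y ∧ idx y < idx j) ∧ ¬ (idx i < idx w ∧ idx w < idx j) ∧
        ¬ (idx j < idx y ∧ idx y < idx i) ∧ ¬ (idx j < idx w ∧ idx w < idx i)) ∨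
      ((idx i ≤ idx y ∧ idx y ≤ idx j) ∧ (idx i ≤ idx w ∧ idx w ≤ idx j)) := by
    intro y hy w hw
    obtain ⟨h1, h2 | h2⟩ := hs
    · have := h2 y hy; have := h2 w hw; omega
    · exact Or.inr ⟨h2 y hy, h2 w hw⟩
  intro x hx
  refine ⟨(key x hx).1, (key x hx).2.1, (key x hx).2.2, ?_⟩
  rintro y hy ⟨l1, l2, l3⟩
  obtain ⟨hxS, hx'⟩ := hx
  obtain ⟨hyS, hy'⟩ := hy
  simp only [Set.mem_insert_iff, Set.mem_singleton_iff, not_or] at hx' hy'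
  have ne : ∀ {a b : α}, a ≠ b → idx a ≠ idx b := fun hab e => hab (hidx e)
  have pne : ∀ {a b : α}, a ∈ S → b ∈ S → π a ≠ b → a ≠ π b := fun ha hb hab e =>
    hab (by rw [e, hinv _ hb])
  have changed : ∀ k k' : α, k ∈ S → k' ∈ S → (k = i ∧ k' = j ∨ k = j ∧ k' = i) →
      ∀ z ∈ S, π z ≠ i → π z ≠ j → z ≠ i → z ≠ j → ∀ w ∈ S, π w = k →
      ¬ (idx w < idx z ∧ idx z < idx (π k') ∧ idx (π k') < idx (π z)) ∧
      ¬ (idx z < idx w ∧ idx w < idx (π z) ∧ idx (π z) < idx (π k')) := by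
    intro k k' hk hk' hkk z hz hzi hzj hzi' hzj' w hw hwk
    have hkz : k ≠ z ∧ k ≠ π z ∧ k' ≠ z ∧ k' ≠ π z := by
      rcases hkk with ⟨rfl, rfl⟩ | ⟨rfl, rfl⟩ <;> grind
    have s := hsep z hz (π z) (hmem z hz)
    have n1 := ne hkz.1; have n2 := ne hkz.2.1; have n3 := ne hkz.2.2.1; have n4 := ne hkz.2.2.2
    have a1 := ncr w hw z hz; have a2 := ncr k' hk' z hz; have a3 := ncr z hz (π k') (hmem _ hk')
    have a4 := ncr z hz w hw; have a5 := ncr k hk z hz; have a6 := ncr z hz k' hk'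
    rw [hinv _ hk'] at a3
    have hkw : π k = w := by rw [← hwk, hinv w hw]
    rw [hkw] at a5
    rw [hwk] at a1 a4
    constructor
    · intro hl
      refine cross_aux (idx w) (idx k) (idx k') (idx (π k')) (idx z) (idx (π z)) a1 a2 a3 hl
        ⟨n1, n2, n3, n4⟩ ?_
      rcases hkk with ⟨rfl, rfl⟩ | ⟨rfl, rfl⟩ <;> omega
    · intro hl
      refine cross_aux' (idx z) (idx k) (idx k') (idx (π z)) (idx w) (idx (π k')) a4 a5 a6 hl
        ⟨n1, n2, n3, n4⟩ ?_
      rcases hkk with ⟨rfl, rfl⟩ | ⟨rfl, rfl⟩ <;> omega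
  have c1 := changed i j hi hj (by simp)
  have c2 := changed j i hj hi (by simp)
  have n := ncr x hxS y hyS
  unfold contractPair at l2 l3
  have i1 := hinv x hxS
  have i2 := hinv y hyS
  have i3 := hinv i hi
  have i4 := hinv j hj
  by_cases xi : π x = i
  · rw [if_pos xi] at l2 l3
    by_cases yj : π y = j
    · grind
    · have yi : π y ≠ i := by grind
      rw [if_neg yi, if_neg yj] at l3
      exact (c1 y hyS yi yj hy'.1 hy'.2 x hxS xi).1 ⟨l1, l2, l3⟩
  · by_cases xj : π x = j
    · rw [if_neg xi, if_pos xj] at l2 l3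
      by_cases yi : π y = i
      · grind
      · have yj : π y ≠ j := by grind
        rw [if_neg yi, if_neg yj] at l3
        exact (c2 y hyS yi yj hy'.1 hy'.2 x hxS xj).1 ⟨l1, l2, l3⟩
    · rw [if_neg xi, if_neg xj] at l2 l3
      by_cases yi : π y = i
      · rw [if_pos yi] at l3
        exact (c1 x hxS xi xj hx'.1 hx'.2 y hyS yi).2 ⟨l1, l2, l3⟩
      · by_cases yj : π y = j
        · rw [if_neg yi, if_pos yj] at l3
          exact (c2 x hxS xi xj hx'.1 hx'.2 y hyS yj).2 ⟨l1, l2, l3⟩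
        · rw [if_neg yi, if_neg yj] at l3
          exact n ⟨l1, l2, l3⟩

theorem contractPair_compat {α : Type} {idx : α → ℕ} {S : Set α}
    {π : α → α} (h : IsNC idx S π) {i j : α} (hi : i ∈ S) (hj : j ∈ S)
    (hij : i ≠ j) (F : α → ZMod 2) :
    (∀ x ∈ S \ {i, j}, F (contractPair π i j x) = F x) ↔
      ∃ G : α → ZMod 2, (∀ x ∈ S \ {i, j}, G x = F x) ∧ G i = G j ∧ ∀ x ∈ S, G (π x) = G x := by
  have e1 := h i hi
  have e2 := h j hj
  constructor
  · intro hF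
    by_cases hp : π i = j
    · refine ⟨fun x => if x = i ∨ x = j then 0 else F x, ?_, by simp, ?_⟩
      · intro x hx
        simp only [Set.mem_sdiff, Set.mem_insert_iff, Set.mem_singleton_iff] at hx
        simp [hx.2]
      · intro x hx
        have h1 := h x hx
        have h2 := hF x
        simp only [Set.mem_sdiff, Set.mem_insert_iff, Set.mem_singleton_iff, contractPair] at *
        grind
    · refine ⟨fun x => if x = i ∨ x = j then F (π i) else F x, ?_, by simp, ?_⟩
      · intro x hx
        simp only [Set.mem_sdiff, Set.mem_insert_iff, Set.mem_singleton_iff] at hx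
        simp [hx.2]
      · intro x hx
        have h1 := h x hx
        have h2 := hF x
        have h3 := hF (π j)
        simp only [Set.mem_sdiff, Set.mem_insert_iff, Set.mem_singleton_iff, contractPair] at *
        grind
  · rintro ⟨G, h1, h2, h3⟩ x hx
    have hx' := h x hx.1
    simp only [Set.mem_sdiff, Set.mem_insert_iff, Set.mem_singleton_iff, contractPair] at *
    grind

/-- The points that are not among the first `i` pairs `u j, v j`. -/
def Uncontracted {α : Type} {k : ℕ} (u v : Fin k → α) (i : ℕ) : Set α :=
  {x | ∀ j : Fin k, (j : ℕ) < i → x ≠ u j ∧ x ≠ v j}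

theorem uncontracted_succ {α : Type} {k : ℕ} (u v : Fin k → α) (i : Fin k) :
    Uncontracted u v (i + 1) = Uncontracted u v i \ {u i, v i} := by
  ext x
  simp only [Uncontracted, Set.mem_ofPred_eq, Set.mem_sdiff, Set.mem_insert_iff,
    Set.mem_singleton_iff, not_or]
  constructor
  · intro h
    exact ⟨fun j hj => h j (by omega), h i (by omega)⟩
  · rintro ⟨h1, h2⟩ j hj
    rcases Nat.lt_succ_iff_lt_or_eq.mp hj with h | h
    · exact h1 j h
    · rw [Fin.ext h]; exact h2

theorem IsNC.contract_iterate {α : Type} {idx : α → ℕ} (hidx : Function.Injective idx)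
    {π : α → α} (h : IsNC idx Set.univ π) {k : ℕ} (u v : Fin k → α)
    (hu : ∀ i : Fin k, u i ∈ Uncontracted u v i) (hv : ∀ i : Fin k, v i ∈ Uncontracted u v i)
    (hs : ∀ i : Fin k, NonSep idx (Uncontracted u v i) (u i) (v i)) (i : ℕ) (hi : i ≤ k) :
    ∃ π' : α → α, IsNC idx (Uncontracted u v i) π' ∧ ∀ F : α → ZMod 2,
      (∀ x ∈ Uncontracted u v i, F (π' x) = F x) ↔
        ∃ G : α → ZMod 2, (∀ x ∈ Uncontracted u v i, G x = F x) ∧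
          (∀ j : Fin k, (j : ℕ) < i → G (u j) = G (v j)) ∧ ∀ x, G (π x) = G x := by
  induction i with
  | zero =>
    have h0 : Uncontracted u v 0 = Set.univ := by ext; simp [Uncontracted]
    refine ⟨π, by rwa [h0], fun F => ?_⟩
    rw [h0]
    constructor
    · intro hF
      exact ⟨F, by simp, by simp, fun x => hF x trivial⟩
    · rintro ⟨G, h1, -, h3⟩ x -
      rw [← h1 x trivial, ← h1 _ trivial, h3]
  | succ i ih =>
    obtain ⟨π', hnc, hF⟩ := ih (by omega)
    have hs' := hs ⟨i, hi⟩
    have hne : u ⟨i, hi⟩ ≠ v ⟨i, hi⟩ := fun e => by have := hs'.1; simp [e] at this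
    have hS := uncontracted_succ u v ⟨i, hi⟩
    simp only at hS hs'
    rw [hS]
    refine ⟨contractPair π' (u ⟨i, hi⟩) (v ⟨i, hi⟩),
      hnc.contract hidx (hu ⟨i, hi⟩) (hv ⟨i, hi⟩) hs', fun F => ?_⟩
    rw [contractPair_compat hnc (hu ⟨i, hi⟩) (hv ⟨i, hi⟩) hne]
    constructor
    · rintro ⟨G, h1, h2, h3⟩
      obtain ⟨H, k1, k2, k3⟩ := (hF G).1 h3
      refine ⟨H, fun x hx => by rw [k1 x hx.1, h1 x hx], fun j hj => ?_, k3⟩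
      rcases Nat.lt_succ_iff_lt_or_eq.mp hj with h | h
      · exact k2 j h
      · rw [show j = ⟨i, hi⟩ from Fin.ext h, k1 _ (hu ⟨i, hi⟩), k1 _ (hv ⟨i, hi⟩), h2]
    · rintro ⟨G, h1, h2, h3⟩
      exact ⟨G, h1, h2 ⟨i, hi⟩ (by simp),
        (hF G).2 ⟨G, fun _ _ => rfl, fun j hj => h2 j (by omega), h3⟩⟩

/-! ### Colourings compatible with a diagram -/

/-- The colouring `F` of the marked points is constant on the strands of `a`. -/
def Compat {m n : ℕ} (a : Diagram m n) (F : Fin m ⊕ Fin n → ZMod 2) : Prop :=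
  ∀ x, F (a.pair x) = F x

theorem compat_zero {m n : ℕ} (a : Diagram m n) : Compat a 0 := fun _ => rfl

theorem Compat.add {m n : ℕ} {a : Diagram m n} {F G : Fin m ⊕ Fin n → ZMod 2}
    (hF : Compat a F) (hG : Compat a G) : Compat a (F + G) := fun x => by
  simp [hF x, hG x]

theorem Compat.sub {m n : ℕ} {a : Diagram m n} {F G : Fin m ⊕ Fin n → ZMod 2}
    (hF : Compat a F) (hG : Compat a G) : Compat a (F - G) := fun x => by
  simp [hF x, hG x]

theorem Diagram.ext_pair {m n : ℕ} {a b : Diagram m n} (h : a.pair = b.pair) : a = b := by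
  cases a; cases b; simpa using h

theorem Diagram.ext_compat {m n : ℕ} {a b : Diagram m n}
    (h : ∀ F, Compat a F → Compat b F) : a = b := by
  refine Diagram.ext_pair (funext fun x => ?_)
  have h1 : Compat a (fun y => if y = x ∨ y = a.pair x then 1 else 0) := by
    intro y
    have e1 : a.pair y = x ↔ y = a.pair x :=
      ⟨fun e => by rw [← e, a.involutive], fun e => by rw [e, a.involutive]⟩
    have e2 : a.pair y = a.pair x ↔ y = x := a.involutive.injective.eq_iff
    simp only [e1, e2, or_comm]
  have h2 := h _ h1 x
  have h3 := b.fixedPointFree x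
  by_contra hne
  simp [h3, Ne.symm hne] at h2

theorem bIdx_injective (m n : ℕ) : Function.Injective (bIdx m n) := by
  rintro (i | i) (j | j) h <;> simp only [bIdx] at h
  · exact congrArg _ (Fin.ext h)
  · omega
  · omega
  · exact congrArg _ (Fin.ext (by omega))

theorem exists_diagram_of_contract {α : Type} {idx : α → ℕ} (hidx : Function.Injective idx)
    {π : α → α} (h : IsNC idx Set.univ π) {k l n : ℕ} (u v : Fin k → α)
    (hu : ∀ i : Fin k, u i ∈ Uncontracted u v i) (hv : ∀ i : Fin k, v i ∈ Uncontracted u v i)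
    (hs : ∀ i : Fin k, NonSep idx (Uncontracted u v i) (u i) (v i))
    (o : Fin l ⊕ Fin n → α) (ho : Set.range o = Uncontracted u v k)
    (hord : ∀ x y, bIdx l n x < bIdx l n y → idx (o x) < idx (o y)) :
    ∃ c : Diagram l n, ∀ F, Compat c F ↔
      ∃ G : α → ZMod 2, (∀ x, G (o x) = F x) ∧ (∀ i, G (u i) = G (v i)) ∧
        ∀ x, G (π x) = G x := by
  obtain ⟨π', hnc, hF⟩ := h.contract_iterate hidx u v hu hv hs k le_rfl
  rw [← ho] at hnc hF
  have oinj : Function.Injective o := by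
    intro x y e
    by_contra hne
    rcases lt_or_gt_of_ne (fun e => hne (bIdx_injective l n e)) with h | h <;>
      · have := hord _ _ h
        simp [e] at this
  have hord' : ∀ x y, idx (o x) < idx (o y) ↔ bIdx l n x < bIdx l n y := by
    intro x y
    refine ⟨fun hlt => ?_, hord x y⟩
    by_contra hge
    rcases lt_or_eq_of_le (not_lt.mp hge) with h | h
    · have := hord _ _ h; omega
    · rw [bIdx_injective l n h] at hlt; omega
  choose c hc using fun x : Fin l ⊕ Fin n => (hnc (o x) ⟨x, rfl⟩).1
  refine ⟨⟨c, fun x => oinj ?_, fun x e => ?_, fun x y => ?_⟩, fun F => ?_⟩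
  · rw [hc, hc, (hnc (o x) ⟨x, rfl⟩).2.1]
  · exact (hnc (o x) ⟨x, rfl⟩).2.2.1 (by rw [← hc, e])
  · rw [← hord', ← hord', ← hord', hc, hc]
    exact (hnc (o x) ⟨x, rfl⟩).2.2.2 (o y) ⟨y, rfl⟩
  · obtain ⟨F', hF'⟩ : ∃ F' : α → ZMod 2, ∀ x, F' (o x) = F x :=
      ⟨Function.extend o F 0, fun x => oinj.extend_apply _ _ _⟩
    have := hF F'
    simp only [Set.forall_mem_range, ← hc, hF'] at this
    simp only [Compat, this]
    simp

/-! ### Composition of diagrams -/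

/-- The boundary order on the points of two stacked diagrams. -/
def stackIdx (l m n : ℕ) : (Fin l ⊕ Fin m) ⊕ (Fin m ⊕ Fin n) → ℕ
  | Sum.inl x => bIdx l m x
  | Sum.inr x => l + m + bIdx m n x

theorem bIdx_lt {m n : ℕ} (x : Fin m ⊕ Fin n) : bIdx m n x < m + n := by
  rcases x with i | i <;> simp only [bIdx] <;> omega

theorem exists_comp_diagram {l m n : ℕ} (a : Diagram l m) (b : Diagram m n) :
    ∃ c : Diagram l n, ∀ (f : Fin l → ZMod 2) (h : Fin n → ZMod 2),
      Compat c (Sum.elim f h) ↔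
        ∃ g, Compat a (Sum.elim f g) ∧ Compat b (Sum.elim g h) := by
  have hidx : Function.Injective (stackIdx l m n) := by
    rintro (x | x) (y | y) e <;> simp only [stackIdx] at e
    · rw [bIdx_injective _ _ e]
    · have := bIdx_lt x; omega
    · have := bIdx_lt y; omega
    · rw [bIdx_injective _ _ (Nat.add_left_cancel e)]
  have hnc : IsNC (stackIdx l m n) Set.univ (Sum.map a.pair b.pair) := by
    rintro (x | x) -
    · refine ⟨trivial, by simp [a.involutive x], by simp [a.fixedPointFree x], ?_⟩
      rintro (y | y) - <;> simp only [stackIdx, Sum.map_inl, Sum.map_inr]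
      · exact a.noncrossing x y
      · have := bIdx_lt (a.pair x); omega
    · refine ⟨trivial, by simp [b.involutive x], by simp [b.fixedPointFree x], ?_⟩
      rintro (y | y) - <;> simp only [stackIdx, Sum.map_inl, Sum.map_inr]
      · have := bIdx_lt (a.pair y); omega
      · have := b.noncrossing x y; omega
  let u : Fin m → (Fin l ⊕ Fin m) ⊕ (Fin m ⊕ Fin n) := fun i => Sum.inl (Sum.inr i)
  let v : Fin m → (Fin l ⊕ Fin m) ⊕ (Fin m ⊕ Fin n) := fun i => Sum.inr (Sum.inl i)
  let o : Fin l ⊕ Fin n → (Fin l ⊕ Fin m) ⊕ (Fin m ⊕ Fin n) :=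
    Sum.elim (fun i => Sum.inl (Sum.inl i)) (fun i => Sum.inr (Sum.inr i))
  have hs : ∀ i : Fin m, NonSep (stackIdx l m n) (Uncontracted u v i) (u i) (v i) := by
    intro i
    refine ⟨by simp only [stackIdx, bIdx, u, v]; omega, Or.inl ?_⟩
    rintro ((x | x) | (x | x)) hx
    · simp only [stackIdx, bIdx, u, v]; omega
    · have : ¬ (x : ℕ) < i := fun hlt => (hx x hlt).1 rfl
      simp only [stackIdx, bIdx, u, v]; omega
    · have : ¬ (x : ℕ) < i := fun hlt => (hx x hlt).2 rfl
      simp only [stackIdx, bIdx, u, v]; omega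
    · simp only [stackIdx, bIdx, u, v]; omega
  have ho : Set.range o = Uncontracted u v m := by
    ext x
    constructor
    · rintro ⟨i | i, rfl⟩ j hj <;> simp [u, v, o]
    · intro hx
      rcases x with (x | x) | (x | x)
      · exact ⟨Sum.inl x, rfl⟩
      · exact absurd rfl (hx x x.2).1
      · exact absurd rfl (hx x x.2).2
      · exact ⟨Sum.inr x, rfl⟩
  have hord : ∀ x y, bIdx l n x < bIdx l n y → stackIdx l m n (o x) < stackIdx l m n (o y) := by
    rintro (x | x) (y | y) <;> simp only [stackIdx, bIdx, Sum.elim_inl, Sum.elim_inr, o] <;> omega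
  obtain ⟨c, hc⟩ := exists_diagram_of_contract hidx hnc u v
    (fun i j hj => by simp [Fin.ext_iff, u, v]; omega)
    (fun i j hj => by simp [Fin.ext_iff, u, v]; omega) hs o ho hord
  refine ⟨c, fun f h => ?_⟩
  rw [hc]
  constructor
  · rintro ⟨G, h1, h2, h3⟩
    refine ⟨fun i => G (Sum.inl (Sum.inr i)), fun x => ?_, fun x => ?_⟩
    · have e : Sum.elim f (fun i => G (Sum.inl (Sum.inr i))) = fun x => G (Sum.inl x) := by
        funext x
        rcases x with i | i
        · exact (h1 (Sum.inl i)).symm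
        · rfl
      rw [e]
      exact h3 (Sum.inl x)
    · have e : Sum.elim (fun i => G (Sum.inl (Sum.inr i))) h = fun x => G (Sum.inr x) := by
        funext x
        rcases x with i | i
        · exact h2 i
        · exact (h1 (Sum.inr i)).symm
      rw [e]
      exact h3 (Sum.inr x)
  · rintro ⟨g, h1, h2⟩
    refine ⟨Sum.elim (Sum.elim f g) (Sum.elim g h), ?_, ?_, ?_⟩
    · rintro (x | x) <;> rfl
    · intro i; rfl
    · rintro (x | x)
      · exact h1 x
      · exact h2 x

/-- The diagram underlying the composite of two diagrams. -/
noncomputable def dcomp {l m n : ℕ} (b : Diagram m n) (a : Diagram l m) : Diagram l n :=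
  (exists_comp_diagram a b).choose

theorem compat_dcomp {l m n : ℕ} {b : Diagram m n} {a : Diagram l m}
    {f : Fin l → ZMod 2} {h : Fin n → ZMod 2} : Compat (dcomp b a) (Sum.elim f h) ↔
      ∃ g, Compat a (Sum.elim f g) ∧ Compat b (Sum.elim g h) :=
  (exists_comp_diagram a b).choose_spec f h

theorem eq_of_step_iff {l m n : ℕ} (a : Diagram l m) (b : Diagram m n) (f : Fin l → ZMod 2)
    (g : Fin m → ZMod 2) (h : Fin n → ZMod 2) :
    (∀ x y, Step a b x y → (Sum.elim f (Sum.elim g h) : Pt l m n → ZMod 2) y =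
        Sum.elim f (Sum.elim g h) x) ↔
      Compat a (Sum.elim f g) ∧ Compat b (Sum.elim g h) := by
  have e1 : ∀ u : Fin l ⊕ Fin m, (Sum.elim f (Sum.elim g h) : Pt l m n → ZMod 2)
      (Sum.map id Sum.inl u) = Sum.elim f g u := by rintro (u | u) <;> rfl
  constructor
  · intro H
    refine ⟨fun u => ?_, fun u => H _ _ (Or.inr ⟨u, rfl, rfl⟩)⟩
    rw [← e1, ← e1]
    exact H _ _ (Or.inl ⟨u, rfl, rfl⟩)
  · rintro ⟨h1, h2⟩ x y (⟨u, rfl, rfl⟩ | ⟨u, rfl, rfl⟩)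
    · rw [e1, e1, h1]
    · exact h2 u

theorem eq_of_conn {l m n : ℕ} {a : Diagram l m} {b : Diagram m n} {f : Fin l → ZMod 2}
    {g : Fin m → ZMod 2} {h : Fin n → ZMod 2} (ha : Compat a (Sum.elim f g))
    (hb : Compat b (Sum.elim g h)) {x y : Pt l m n} (hxy : Conn a b x y) :
    (Sum.elim f (Sum.elim g h) : Pt l m n → ZMod 2) y = Sum.elim f (Sum.elim g h) x := by
  induction hxy with
  | rel x y s => exact (eq_of_step_iff a b f g h).2 ⟨ha, hb⟩ x y s
  | refl x => rfl
  | symm x y _ ih => exact ih.symm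
  | trans x y z _ _ ih1 ih2 => exact ih2.trans ih1

theorem conn_dcomp_iff {l m n : ℕ} (a : Diagram l m) (b : Diagram m n) (c : Diagram l n) :
    (∀ x : Fin l ⊕ Fin n, Conn a b (Sum.map id Sum.inr x) (Sum.map id Sum.inr (c.pair x))) ↔
      c = dcomp b a := by
  constructor
  · intro hc
    refine (Diagram.ext_compat fun F hF => ?_).symm
    obtain ⟨f, h, rfl⟩ : ∃ f h, F = Sum.elim f h :=
      ⟨_, _, (Sum.elim_comp_inl_inr F).symm⟩
    obtain ⟨g, h1, h2⟩ := compat_dcomp.1 hF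
    intro x
    have e : ∀ x : Fin l ⊕ Fin n, (Sum.elim f (Sum.elim g h) : Pt l m n → ZMod 2)
        (Sum.map id Sum.inr x) = Sum.elim f h x := by rintro (x | x) <;> rfl
    rw [← e, ← e]
    exact eq_of_conn h1 h2 (hc x)
  · rintro rfl x
    let F : Pt l m n → ZMod 2 := fun y => if Conn a b (Sum.map id Sum.inr x) y then 1 else 0
    obtain ⟨f, g, h, hF⟩ : ∃ f g h, F = Sum.elim f (Sum.elim g h) :=
      ⟨F ∘ Sum.inl, F ∘ Sum.inr ∘ Sum.inl, F ∘ Sum.inr ∘ Sum.inr, by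
        funext y; rcases y with y | y | y <;> rfl⟩
    have hstep := (eq_of_step_iff a b f g h).1 (by
      intro y z s
      rw [← hF]
      have : Conn a b (Sum.map id Sum.inr x) z ↔ Conn a b (Sum.map id Sum.inr x) y :=
        ⟨fun k => k.trans _ _ _ (.symm _ _ (.rel _ _ s)), fun k => k.trans _ _ _ (.rel _ _ s)⟩
      simp only [F, this])
    have hc := compat_dcomp.2 ⟨g, hstep⟩ x
    have e : ∀ x : Fin l ⊕ Fin n, F (Sum.map id Sum.inr x) = Sum.elim f h x := by
      rw [hF]; rintro (x | x) <;> rfl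
    rw [← e, ← e] at hc
    have h1 : F (Sum.map id Sum.inr x) = 1 := if_pos (.refl _)
    rw [h1] at hc
    by_contra hcon
    simp [F, hcon] at hc

theorem compD_eq (d : K) {l m n : ℕ} (b : Diagram m n) (a : Diagram l m) :
    compD d b a = d ^ numLoops a b • single (dcomp b a) := by
  funext c
  simp only [compD, conn_dcomp_iff, Pi.smul_apply, single, smul_eq_mul, mul_ite, mul_one, mul_zero]

/-! ### Transfer matrices -/

/-- The transfer matrix of a diagram: the `(f, g)` entry is `1` if colouring the top points
by `f` and the bottom points by `g` is constant on strands, and `0` otherwise. -/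
noncomputable def mat {m n : ℕ} (a : Diagram m n) :
    Matrix (Fin m → ZMod 2) (Fin n → ZMod 2) ℕ :=
  fun f g => if Compat a (Sum.elim f g) then 1 else 0

theorem mat_zero_zero {m n : ℕ} (a : Diagram m n) : mat a 0 0 = 1 :=
  if_pos fun x => by rcases x with x | x <;> rcases a.pair _ with y | y <;> rfl

theorem mat_injective {m n : ℕ} {a b : Diagram m n} (h : mat a = mat b) : a = b := by
  refine Diagram.ext_compat fun F hF => ?_
  obtain ⟨f, g, rfl⟩ : ∃ f h, F = Sum.elim f h := ⟨_, _, (Sum.elim_comp_inl_inr F).symm⟩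
  have := congrFun (congrFun h f) g
  simp only [mat, if_pos hF] at this
  by_contra hb
  simp [hb] at this

theorem pow_smul_mat_injective {m n r s : ℕ} {a b : Diagram m n}
    (h : 2 ^ r • mat a = 2 ^ s • mat b) : r = s ∧ a = b := by
  have h0 := congrFun (congrFun h 0) 0
  simp only [Matrix.smul_apply, mat_zero_zero, smul_eq_mul, mul_one] at h0
  have hr : r = s := Nat.pow_right_injective le_rfl h0
  subst hr
  refine ⟨rfl, mat_injective ?_⟩
  ext f g
  have := congrFun (congrFun h f) g
  simpa using this

theorem elim_sub_elim {α β : Type} (f f' : α → ZMod 2) (g g' : β → ZMod 2) :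
    (Sum.elim f g - Sum.elim f' g' : α ⊕ β → ZMod 2) = Sum.elim (f - f') (g - g') := by
  funext x; rcases x with x | x <;> rfl

theorem elim_add_elim {α β : Type} (f f' : α → ZMod 2) (g g' : β → ZMod 2) :
    (Sum.elim f g + Sum.elim f' g' : α ⊕ β → ZMod 2) = Sum.elim (f + f') (g + g') := by
  funext x; rcases x with x | x <;> rfl

/-- The middle colourings compatible with the zero colouring of the outer points. -/
def Inner {l m n : ℕ} (a : Diagram l m) (b : Diagram m n) (g : Fin m → ZMod 2) : Prop :=
  Compat a (Sum.elim 0 g) ∧ Compat b (Sum.elim g 0)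

theorem card_inner {l m n : ℕ} (a : Diagram l m) (b : Diagram m n) :
    Nat.card {g // Inner a b g} = 2 ^ numLoops a b := by
  unfold numLoops
  set s : Setoid (ClosedMid a b) := ⟨fun x y : ClosedMid a b => Conn a b x.1 y.1,
    ⟨fun _ => Relation.EqvGen.refl _, fun h => Relation.EqvGen.symm _ _ h,
      fun h h' => Relation.EqvGen.trans _ _ _ h h'⟩⟩ with hs
  have hfin : Finite (Quotient s) := inferInstance
  have hcard : Nat.card (Quotient s → ZMod 2) = 2 ^ Nat.card (Quotient s) := by
    rw [Nat.card_fun, Nat.card_zmod]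
  rw [← hcard]
  symm
  have conn_mem : ∀ {x y : Pt l m n}, Conn a b x y → x ∈ ClosedMid a b → y ∈ ClosedMid a b :=
    fun {x y} hxy hx => ⟨hx.2 y hxy, fun z hz => hx.2 z (hxy.trans _ _ _ hz)⟩
  let G : (Quotient s → ZMod 2) → Pt l m n → ZMod 2 := fun χ x =>
    if h : x ∈ ClosedMid a b then χ (Quotient.mk s ⟨x, h⟩) else 0
  have Gconn : ∀ χ x y, Conn a b x y → G χ y = G χ x := by
    intro χ x y hxy
    by_cases hx : x ∈ ClosedMid a b
    · have hy := conn_mem hxy hx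
      simp only [G, dif_pos hx, dif_pos hy]
      congr 1
      exact Quotient.sound (s := s) (hxy.symm)
    · have hy : y ∉ ClosedMid a b := fun hy => hx (conn_mem (hxy.symm) hy)
      simp only [G, dif_neg hx, dif_neg hy]
  have Gelim : ∀ χ, G χ = (Sum.elim 0
      (Sum.elim (fun j => G χ (Sum.inr (Sum.inl j))) 0) : Pt l m n → ZMod 2) := by
    intro χ
    funext x
    rcases x with x | x | x
    · exact dif_neg fun h => by obtain ⟨j, hj⟩ := h.1; simp at hj
    · rfl
    · exact dif_neg fun h => by obtain ⟨j, hj⟩ := h.1; simp at hj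
  refine Nat.card_congr (Equiv.ofBijective
    (fun χ => ⟨fun j => G χ (Sum.inr (Sum.inl j)), ?_⟩) ⟨?_, ?_⟩)
  · refine (eq_of_step_iff a b _ _ _).1 fun x y hxy => ?_
    rw [← Gelim]
    exact Gconn χ x y (.rel _ _ hxy)
  · intro χ χ' h
    funext q
    obtain ⟨⟨x, hx⟩, rfl⟩ := Quotient.exists_rep q
    obtain ⟨j, rfl⟩ := hx.1
    have := congrFun (congrArg Subtype.val h) j
    simpa only [G, dif_pos hx] using this
  · rintro ⟨g, hg⟩
    let F : Pt l m n → ZMod 2 := Sum.elim 0 (Sum.elim g 0)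
    have hF : ∀ x y, Conn a b x y → F y = F x := fun x y hxy => eq_of_conn hg.1 hg.2 hxy
    refine ⟨Quotient.lift (fun x => F x.1) fun x y hxy => (hF _ _ hxy).symm, ?_⟩
    apply Subtype.ext
    funext j
    by_cases hj : (Sum.inr (Sum.inl j) : Pt l m n) ∈ ClosedMid a b
    · simp only [G, dif_pos hj]
      rfl
    · simp only [G, dif_neg hj]
      have : ∃ y, Conn a b (Sum.inr (Sum.inl j)) y ∧ ∀ i, y ≠ Sum.inr (Sum.inl i) := by
        by_contra hcon
        push Not at hcon
        exact hj ⟨⟨j, rfl⟩, hcon⟩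
      obtain ⟨y, hy, hne⟩ := this
      have h0 : F y = 0 := by
        rcases y with y | y | y
        · rfl
        · exact absurd rfl (hne y)
        · rfl
      rw [← h0, hF _ _ hy]
      rfl

theorem mat_mul_mat {l m n : ℕ} (b : Diagram m n) (a : Diagram l m) :
    mat a * mat b = 2 ^ numLoops a b • mat (dcomp b a) := by
  ext f h
  rw [Matrix.mul_apply, Matrix.smul_apply, ← card_inner]
  simp only [mat, ← ite_and, mul_ite, mul_one, mul_zero, smul_eq_mul, compat_dcomp]
  have e1 : ∀ g, (Compat b (Sum.elim g h) ∧ Compat a (Sum.elim f g)) ↔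
      (Compat a (Sum.elim f g) ∧ Compat b (Sum.elim g h)) := fun g => and_comm
  simp only [e1, Finset.sum_boole, Nat.cast_id]
  split_ifs with hg
  · obtain ⟨g₀, h1, h2⟩ := hg
    rw [Nat.card_eq_fintype_card, Fintype.card_subtype]
    refine Finset.card_bij (fun g _ => g - g₀) ?_ ?_ ?_
    · intro g hg
      simp only [Finset.mem_filter, Finset.mem_univ, true_and] at hg ⊢
      have k1 := hg.1.sub h1
      have k2 := hg.2.sub h2
      rw [elim_sub_elim, sub_self] at k1 k2
      exact ⟨k1, k2⟩
    · intro g _ g' _ e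
      exact sub_left_injective e
    · intro g hg
      simp only [Finset.mem_filter, Finset.mem_univ, true_and] at hg
      refine ⟨g + g₀, ?_, by simp⟩
      have k1 := hg.1.add h1
      have k2 := hg.2.add h2
      rw [elim_add_elim, zero_add] at k1 k2
      simpa using ⟨k1, k2⟩
  · rw [Finset.card_eq_zero, Finset.filter_eq_empty_iff]
    exact fun g _ hh => hg ⟨g, hh⟩

/-! ### Bilinearity and reduction to diagrams -/

section Linear

variable {d : K} {l m n m' n' : ℕ}

theorem comp_add (b : Hom K m n) (a a' : Hom K l m) :
    comp d b (a + a') = comp d b a + comp d b a' := by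
  funext c
  simp only [comp, Pi.add_apply, mul_add, add_mul, Finset.sum_add_distrib]

theorem add_comp (b b' : Hom K m n) (a : Hom K l m) :
    comp d (b + b') a = comp d b a + comp d b' a := by
  funext c
  simp only [comp, Pi.add_apply, add_mul, Finset.sum_add_distrib]

theorem comp_smul (k : K) (b : Hom K m n) (a : Hom K l m) :
    comp d b (k • a) = k • comp d b a := by
  funext c
  simp only [comp, Pi.smul_apply, smul_eq_mul, Finset.mul_sum]
  exact Finset.sum_congr rfl fun _ _ => Finset.sum_congr rfl fun _ _ => by ring

theorem smul_comp (k : K) (b : Hom K m n) (a : Hom K l m) :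
    comp d (k • b) a = k • comp d b a := by
  funext c
  simp only [comp, Pi.smul_apply, smul_eq_mul, Finset.mul_sum]
  exact Finset.sum_congr rfl fun _ _ => Finset.sum_congr rfl fun _ _ => by ring

theorem comp_zero (b : Hom K m n) : comp d b (0 : Hom K l m) = 0 := by
  simpa using comp_smul (d := d) 0 b (0 : Hom K l m)

theorem zero_comp (a : Hom K l m) : comp d (0 : Hom K m n) a = 0 := by
  simpa using smul_comp (d := d) 0 (0 : Hom K m n) a

theorem comp_sub (b : Hom K m n) (a a' : Hom K l m) :
    comp d b (a - a') = comp d b a - comp d b a' := by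
  rw [sub_eq_add_neg, ← neg_one_smul K a', comp_add, comp_smul, neg_one_smul, sub_eq_add_neg]

theorem sub_comp (b b' : Hom K m n) (a : Hom K l m) :
    comp d (b - b') a = comp d b a - comp d b' a := by
  rw [sub_eq_add_neg, ← neg_one_smul K b', add_comp, smul_comp, neg_one_smul, sub_eq_add_neg]

theorem tensor_add (b : Hom K m n) (a a' : Hom K m' n') :
    tensor b (a + a') = tensor b a + tensor b a' := by
  funext c
  simp only [tensor, Pi.add_apply, mul_add, add_mul, Finset.sum_add_distrib]

theorem add_tensor (b b' : Hom K m n) (a : Hom K m' n') :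
    tensor (b + b') a = tensor b a + tensor b' a := by
  funext c
  simp only [tensor, Pi.add_apply, add_mul, Finset.sum_add_distrib]

theorem tensor_smul (k : K) (b : Hom K m n) (a : Hom K m' n') :
    tensor b (k • a) = k • tensor b a := by
  funext c
  simp only [tensor, Pi.smul_apply, smul_eq_mul, Finset.mul_sum]
  exact Finset.sum_congr rfl fun _ _ => Finset.sum_congr rfl fun _ _ => by ring

theorem smul_tensor (k : K) (b : Hom K m n) (a : Hom K m' n') :
    tensor (k • b) a = k • tensor b a := by
  funext c
  simp only [tensor, Pi.smul_apply, smul_eq_mul, Finset.mul_sum]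
  exact Finset.sum_congr rfl fun _ _ => Finset.sum_congr rfl fun _ _ => by ring

theorem tensor_zero (b : Hom K m n) : tensor b (0 : Hom K m' n') = 0 := by
  simpa using tensor_smul 0 b (0 : Hom K m' n')

theorem zero_tensor (a : Hom K m' n') : tensor (0 : Hom K m n) a = 0 := by
  simpa using smul_tensor 0 (0 : Hom K m n) a

theorem Tr_add (a b : Hom K n n) : Tr d (a + b) = Tr d a + Tr d b := by
  simp only [Tr, Pi.add_apply, add_mul, Finset.sum_add_distrib]

theorem Tr_smul (k : K) (a : Hom K n n) : Tr d (k • a) = k * Tr d a := by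
  simp only [Tr, Pi.smul_apply, smul_eq_mul, Finset.mul_sum, mul_assoc]

theorem Tr_zero : Tr d (0 : Hom K n n) = 0 := by simp [Tr]

theorem Tr_single (a : Diagram n n) : Tr d (single a : Hom K n n) = d ^ trLoops a := by
  simp [Tr, single]

theorem comp_single (b : Diagram m n) (a : Diagram l m) :
    comp d (single b) (single a) = d ^ numLoops a b • single (dcomp b a) := by
  rw [← compD_eq]
  funext c
  simp only [comp, single, ite_mul, one_mul, zero_mul, Finset.sum_ite_eq', mul_ite, mul_one,
    mul_zero, Finset.mem_univ, if_true]

theorem hom_eq_sum (x : Hom K m n) : x = ∑ p, x p • single p := by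
  funext c
  simp [single, Finset.sum_apply]

theorem hom_induction {P : Hom K m n → Prop} (x : Hom K m n) (h0 : P 0)
    (hadd : ∀ a b, P a → P b → P (a + b)) (hs : ∀ (k : K) (p : Diagram m n), P (k • single p)) :
    P x := by
  rw [hom_eq_sum x]
  exact Finset.sum_induction _ P hadd h0 fun p _ => hs _ _

theorem idHom_eq_single : idHom K n = single (idD n) := rfl

end Linear

/-! ### Associativity and identities -/

theorem compat_idD {n : ℕ} {f g : Fin n → ZMod 2} :
    Compat (idD n) (Sum.elim f g) ↔ f = g := by
  constructor
  · intro h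
    funext i
    exact h (Sum.inr i)
  · rintro rfl (i | i) <;> rfl

theorem mat_idD (n : ℕ) : mat (idD n) = 1 := by
  ext f g
  simp only [mat, compat_idD, Matrix.one_apply]

theorem comp_assoc {d : K} {k l m n : ℕ} (c : Hom K m n) (b : Hom K l m) (a : Hom K k l) :
    comp d c (comp d b a) = comp d (comp d c b) a := by
  induction c using hom_induction with
  | h0 => simp only [zero_comp]
  | hadd c c' h h' => simp only [add_comp, h, h']
  | hs r c =>
    simp only [smul_comp]
    congr 1
    induction b using hom_induction with
    | h0 => simp only [zero_comp, comp_zero]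
    | hadd b b' h h' => simp only [add_comp, comp_add, h, h']
    | hs r b =>
      simp only [smul_comp, comp_smul]
      congr 1
      induction a using hom_induction with
      | h0 => simp only [comp_zero]
      | hadd a a' h h' => simp only [comp_add, h, h']
      | hs r a =>
        simp only [comp_smul, comp_single, smul_comp, smul_smul, ← pow_add]
        have key : 2 ^ (numLoops a b + numLoops (dcomp b a) c) • mat (dcomp c (dcomp b a)) =
            2 ^ (numLoops b c + numLoops a (dcomp c b)) • mat (dcomp (dcomp c b) a) := by
          rw [pow_add, pow_add, mul_smul, mul_smul, ← mat_mul_mat, ← mat_mul_mat,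
            ← Matrix.smul_mul, ← Matrix.mul_smul, ← mat_mul_mat, ← mat_mul_mat,
            Matrix.mul_assoc]
        obtain ⟨h1, h2⟩ := pow_smul_mat_injective key
        rw [h2, ← h1, pow_add, mul_assoc]

/-- A composition of diagrams which produces no closed loops. -/
theorem comp_single_of_unique {d : K} {l m n : ℕ} {b : Diagram m n} {a : Diagram l m}
    {c : Diagram l n} (hc : ∀ f h, Compat c (Sum.elim f h) ↔
      ∃ g, Compat a (Sum.elim f g) ∧ Compat b (Sum.elim g h))
    (h0 : ∀ g, Inner a b g → g = 0) : comp d (single b) (single a) = (single c : Hom K l n) := by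
  have h1 : c = dcomp b a := by
    refine mat_injective ?_
    ext f h
    simp only [mat, hc, compat_dcomp]
  have h2 : numLoops a b = 0 := by
    have h := card_inner a b
    have : Unique {g // Inner a b g} :=
      ⟨⟨⟨0, by
        have hz : ∀ p q : ℕ, (Sum.elim 0 0 : Fin p ⊕ Fin q → ZMod 2) = 0 := fun p q => by
          funext x; rcases x with x | x <;> rfl
        constructor <;> rw [hz] <;> exact compat_zero _⟩⟩, fun x => Subtype.ext (h0 x.1 x.2)⟩
    rw [Nat.card_unique] at h
    by_contra hne
    have := Nat.one_lt_two_pow hne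
    omega
  rw [comp_single, h2, pow_zero, one_smul, h1]

theorem id_comp {d : K} {m n : ℕ} (a : Hom K m n) : comp d (idHom K n) a = a := by
  induction a using hom_induction with
  | h0 => simp only [comp_zero]
  | hadd a a' h h' => simp only [comp_add, h, h']
  | hs r a =>
    rw [comp_smul, idHom_eq_single]
    congr 1
    refine comp_single_of_unique (fun f h => ?_) (fun g hg => compat_idD.1 hg.2)
    simp only [compat_idD, exists_eq_right]

theorem comp_id {d : K} {m n : ℕ} (a : Hom K m n) : comp d a (idHom K m) = a := by
  induction a using hom_induction with
  | h0 => simp only [zero_comp]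
  | hadd a a' h h' => simp only [add_comp, h, h']
  | hs r a =>
    rw [smul_comp, idHom_eq_single]
    congr 1
    refine comp_single_of_unique (fun f h => ?_) (fun g hg => (compat_idD.1 hg.1).symm)
    simp only [compat_idD, exists_eq_left']

/-! ### The Markov trace is a trace -/

theorem compat_elim_self_iff {n : ℕ} (p : Diagram n n) (F : Fin n ⊕ Fin n → ZMod 2) :
    (∀ x y, closeStep p x y → F y = F x) ↔
      Compat p F ∧ ∀ i, F (Sum.inl i) = F (Sum.inr i) := by
  constructor
  · intro h
    exact ⟨fun x => h _ _ (Or.inl rfl), fun i => h (Sum.inr i) _ (Or.inr rfl)⟩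
  · rintro ⟨h1, h2⟩ x y (rfl | rfl)
    · exact h1 x
    · rcases x with i | i
      · exact (h2 i).symm
      · exact h2 i

theorem trace_mat {n : ℕ} (p : Diagram n n) : (mat p).trace = 2 ^ trLoops p := by
  have h1 : (mat p).trace = Nat.card {f : Fin n → ZMod 2 // Compat p (Sum.elim f f)} := by
    rw [Nat.card_eq_fintype_card, Fintype.card_subtype]
    simp only [Matrix.trace, Matrix.diag, mat, Finset.sum_boole, Nat.cast_id]
  have h2 : 2 ^ trLoops p =
      Nat.card (Quotient (Relation.EqvGen.setoid (closeStep p)) → ZMod 2) := by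
    have hfin : Finite (Quotient (Relation.EqvGen.setoid (closeStep p))) := inferInstance
    rw [Nat.card_fun, Nat.card_zmod, trLoops]
  rw [h1, h2]
  have lift : ∀ F : Fin n ⊕ Fin n → ZMod 2, (∀ x y, closeStep p x y → F y = F x) →
      ∀ x y, Relation.EqvGen (closeStep p) x y → F x = F y := by
    intro F hF x y hxy
    induction hxy with
    | rel x y s => exact (hF x y s).symm
    | refl x => rfl
    | symm x y _ ih => exact ih.symm
    | trans x y z _ _ ih1 ih2 => exact ih1.trans ih2
  symm
  have fwd : ∀ χ : Quotient (Relation.EqvGen.setoid (closeStep p)) → ZMod 2,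
      Compat p (fun x => χ (Quotient.mk _ x)) ∧
      ∀ i, χ (Quotient.mk _ (Sum.inl i)) = χ (Quotient.mk _ (Sum.inr i)) := by
    intro χ
    refine (compat_elim_self_iff p (fun x => χ (Quotient.mk _ x))).1 fun x y s => ?_
    exact congrArg χ (Quotient.sound ((Relation.EqvGen.rel _ _ s).symm))
  have elim_eq : ∀ χ : Quotient (Relation.EqvGen.setoid (closeStep p)) → ZMod 2,
      Sum.elim (fun i : Fin n => χ (Quotient.mk _ (Sum.inl i)))
        (fun i : Fin n => χ (Quotient.mk _ (Sum.inl i))) = fun x => χ (Quotient.mk _ x) := by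
    intro χ
    funext x
    rcases x with i | i
    · rfl
    · exact (fwd χ).2 i
  refine Nat.card_congr (Equiv.ofBijective
    (fun χ => ⟨fun i => χ (Quotient.mk _ (Sum.inl i)), ?_⟩) ⟨?_, ?_⟩)
  · rw [elim_eq]
    exact (fwd χ).1
  · intro χ χ' h
    funext q
    obtain ⟨x, rfl⟩ := Quotient.exists_rep q
    have h' := congrArg (fun f : Fin n → ZMod 2 => Sum.elim f f x) (congrArg Subtype.val h)
    simpa only [elim_eq] using h'
  · rintro ⟨f, hf⟩
    refine ⟨Quotient.lift (Sum.elim f f)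
      (lift _ ((compat_elim_self_iff p _).2 ⟨hf, fun _ => rfl⟩)), ?_⟩
    rfl

theorem Tr_comp_comm {d : K} {m n : ℕ} (b : Hom K n m) (a : Hom K m n) :
    Tr d (comp d b a) = Tr d (comp d a b) := by
  induction a using hom_induction with
  | h0 => simp only [comp_zero, zero_comp, Tr_zero]
  | hadd a a' h h' => simp only [comp_add, add_comp, Tr_add, h, h']
  | hs r a =>
    simp only [comp_smul, smul_comp, Tr_smul]
    congr 1
    induction b using hom_induction with
    | h0 => simp only [comp_zero, zero_comp, Tr_zero]
    | hadd b b' h h' => simp only [comp_add, add_comp, Tr_add, h, h']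
    | hs r b =>
      simp only [comp_smul, smul_comp, Tr_smul, comp_single, Tr_single, ← pow_add]
      have key : 2 ^ (numLoops a b + trLoops (dcomp b a)) =
          2 ^ (numLoops b a + trLoops (dcomp a b)) := by
        rw [pow_add, pow_add, ← trace_mat, ← trace_mat, ← smul_eq_mul, ← smul_eq_mul,
          ← Matrix.trace_smul, ← Matrix.trace_smul, ← mat_mul_mat, ← mat_mul_mat,
          Matrix.trace_mul_comm]
      rw [Nat.pow_right_injective le_rfl key]

/-! ### Tensor products of diagrams -/

theorem tensorPair_inl_castAdd {m n m' n' : ℕ} (a : Diagram m n) (b : Diagram m' n')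
    (i : Fin m) : tensorPair a b (Sum.inl (Fin.castAdd m' i)) =
      Sum.map (Fin.castAdd m') (Fin.castAdd n') (a.pair (Sum.inl i)) := by
  rcases h : a.pair (Sum.inl i) with j | j <;> simp [tensorPair, tEquiv, h]

theorem tensorPair_inr_castAdd {m n m' n' : ℕ} (a : Diagram m n) (b : Diagram m' n')
    (i : Fin n) : tensorPair a b (Sum.inr (Fin.castAdd n' i)) =
      Sum.map (Fin.castAdd m') (Fin.castAdd n') (a.pair (Sum.inr i)) := by
  rcases h : a.pair (Sum.inr i) with j | j <;> simp [tensorPair, tEquiv, h]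

theorem tensorPair_inl_natAdd {m n m' n' : ℕ} (a : Diagram m n) (b : Diagram m' n')
    (i : Fin m') : tensorPair a b (Sum.inl (Fin.natAdd m i)) =
      Sum.map (Fin.natAdd m) (Fin.natAdd n) (b.pair (Sum.inl i)) := by
  rcases h : b.pair (Sum.inl i) with j | j <;> simp [tensorPair, tEquiv, h]

theorem tensorPair_inr_natAdd {m n m' n' : ℕ} (a : Diagram m n) (b : Diagram m' n')
    (i : Fin n') : tensorPair a b (Sum.inr (Fin.natAdd n i)) =
      Sum.map (Fin.natAdd m) (Fin.natAdd n) (b.pair (Sum.inr i)) := by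
  rcases h : b.pair (Sum.inr i) with j | j <;> simp [tensorPair, tEquiv, h]

/-- Every point of a juxtaposition of diagrams belongs to the left or the right diagram. -/
theorem tensor_point_cases {m n m' n' : ℕ} (x : Fin (m + m') ⊕ Fin (n + n')) :
    (∃ y : Fin m ⊕ Fin n, x = Sum.map (Fin.castAdd m') (Fin.castAdd n') y) ∨
    (∃ y : Fin m' ⊕ Fin n', x = Sum.map (Fin.natAdd m) (Fin.natAdd n) y) := by
  rcases x with i | i
  · refine Fin.addCases (fun i => ?_) (fun i => ?_) i
    · exact Or.inl ⟨Sum.inl i, rfl⟩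
    · exact Or.inr ⟨Sum.inl i, rfl⟩
  · refine Fin.addCases (fun i => ?_) (fun i => ?_) i
    · exact Or.inl ⟨Sum.inr i, rfl⟩
    · exact Or.inr ⟨Sum.inr i, rfl⟩

theorem tensorPair_left {m n m' n' : ℕ} (a : Diagram m n) (b : Diagram m' n')
    (y : Fin m ⊕ Fin n) : tensorPair a b (Sum.map (Fin.castAdd m') (Fin.castAdd n') y) =
      Sum.map (Fin.castAdd m') (Fin.castAdd n') (a.pair y) := by
  rcases y with i | i
  · exact tensorPair_inl_castAdd a b i
  · exact tensorPair_inr_castAdd a b i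

theorem tensorPair_right {m n m' n' : ℕ} (a : Diagram m n) (b : Diagram m' n')
    (y : Fin m' ⊕ Fin n') : tensorPair a b (Sum.map (Fin.natAdd m) (Fin.natAdd n) y) =
      Sum.map (Fin.natAdd m) (Fin.natAdd n) (b.pair y) := by
  rcases y with i | i
  · exact tensorPair_inl_natAdd a b i
  · exact tensorPair_inr_natAdd a b i

theorem bIdx_left {m n m' n' : ℕ} (y : Fin m ⊕ Fin n) :
    (bIdx (m + m') (n + n') (Sum.map (Fin.castAdd m') (Fin.castAdd n') y) = bIdx m n y ∧
      bIdx m n y < m) ∨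
    (bIdx (m + m') (n + n') (Sum.map (Fin.castAdd m') (Fin.castAdd n') y) =
      bIdx m n y + (m' + n') ∧ m ≤ bIdx m n y) := by
  rcases y with i | i <;> simp [bIdx] <;> omega

theorem bIdx_right {m n m' n' : ℕ} (y : Fin m' ⊕ Fin n') :
    bIdx (m + m') (n + n') (Sum.map (Fin.natAdd m) (Fin.natAdd n) y) = m + bIdx m' n' y := by
  rcases y with i | i <;> simp [bIdx] <;> omega

/-- The horizontal juxtaposition of two diagrams. -/
def dtensor {m n m' n' : ℕ} (a : Diagram m n) (b : Diagram m' n') :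
    Diagram (m + m') (n + n') where
  pair := tensorPair a b
  involutive := by
    intro x
    rcases tensor_point_cases x with ⟨y, rfl⟩ | ⟨y, rfl⟩
    · rw [tensorPair_left, tensorPair_left, a.involutive]
    · rw [tensorPair_right, tensorPair_right, b.involutive]
  fixedPointFree := by
    intro x
    rcases tensor_point_cases x with ⟨y, rfl⟩ | ⟨y, rfl⟩
    · rw [tensorPair_left]
      exact fun e => a.fixedPointFree y (Sum.map_injective.2
        ⟨Fin.castAdd_injective _ _, Fin.castAdd_injective _ _⟩ e)
    · rw [tensorPair_right]
      exact fun e => b.fixedPointFree y (Sum.map_injective.2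
        ⟨Fin.natAdd_injective _ _, Fin.natAdd_injective _ _⟩ e)
  noncrossing := by
    intro x z
    rcases tensor_point_cases x with ⟨y, rfl⟩ | ⟨y, rfl⟩ <;>
      rcases tensor_point_cases z with ⟨w, rfl⟩ | ⟨w, rfl⟩
    · rw [tensorPair_left, tensorPair_left]
      have := a.noncrossing y w
      have := bIdx_left (m' := m') (n' := n') y
      have := bIdx_left (m' := m') (n' := n') w
      have := bIdx_left (m' := m') (n' := n') (a.pair y)
      have := bIdx_left (m' := m') (n' := n') (a.pair w)
      omega
    · rw [tensorPair_left, tensorPair_right]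
      have := bIdx_left (m' := m') (n' := n') y
      have := bIdx_left (m' := m') (n' := n') (a.pair y)
      have := bIdx_lt w
      have := bIdx_lt (b.pair w)
      rw [bIdx_right, bIdx_right]
      omega
    · rw [tensorPair_left, tensorPair_right]
      have := bIdx_left (m' := m') (n' := n') w
      have := bIdx_left (m' := m') (n' := n') (a.pair w)
      have := bIdx_lt y
      have := bIdx_lt (b.pair y)
      rw [bIdx_right, bIdx_right]
      omega
    · rw [tensorPair_right, tensorPair_right]
      have := b.noncrossing y w
      rw [bIdx_right, bIdx_right, bIdx_right, bIdx_right]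
      omega

theorem tensor_single {m n m' n' : ℕ} (a : Diagram m n) (b : Diagram m' n') :
    tensor (single a) (single b) = (single (dtensor a b) : Hom K (m + m') (n + n')) := by
  have h : (tensorD a b : Hom K (m + m') (n + n')) = single (dtensor a b) := by
    funext c
    have : c.pair = tensorPair a b ↔ c = dtensor a b :=
      ⟨fun e => Diagram.ext_pair e, fun e => by rw [e]; rfl⟩
    simp only [tensorD, single, this]
  rw [← h]
  funext c
  simp only [tensor, single, ite_mul, one_mul, zero_mul, Finset.sum_ite_eq', mul_ite, mul_one,
    mul_zero, Finset.mem_univ, if_true]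

theorem compat_dtensor {m n m' n' : ℕ} {a : Diagram m n} {b : Diagram m' n'}
    {f : Fin (m + m') → ZMod 2} {g : Fin (n + n') → ZMod 2} :
    Compat (dtensor a b) (Sum.elim f g) ↔
      Compat a (Sum.elim (fun i => f (Fin.castAdd m' i)) (fun i => g (Fin.castAdd n' i))) ∧
      Compat b (Sum.elim (fun i => f (Fin.natAdd m i)) (fun i => g (Fin.natAdd n i))) := by
  have e1 : ∀ y, Sum.elim f g (Sum.map (Fin.castAdd m') (Fin.castAdd n') y) =
      Sum.elim (fun i => f (Fin.castAdd m' i)) (fun i => g (Fin.castAdd n' i)) y := by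
    rintro (y | y) <;> rfl
  have e2 : ∀ y, Sum.elim f g (Sum.map (Fin.natAdd m) (Fin.natAdd n) y) =
      Sum.elim (fun i => f (Fin.natAdd m i)) (fun i => g (Fin.natAdd n i)) y := by
    rintro (y | y) <;> rfl
  constructor
  · intro h
    refine ⟨fun y => ?_, fun y => ?_⟩
    · rw [← e1, ← e1, ← tensorPair_left a b]
      exact h _
    · rw [← e2, ← e2, ← tensorPair_right a b]
      exact h _
  · rintro ⟨h1, h2⟩ x
    rcases tensor_point_cases x with ⟨y, rfl⟩ | ⟨y, rfl⟩
    · change Sum.elim f g (tensorPair a b _) = _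
      rw [tensorPair_left, e1, e1, h1]
    · change Sum.elim f g (tensorPair a b _) = _
      rw [tensorPair_right, e2, e2, h2]

theorem mat_dtensor {m n m' n' : ℕ} (a : Diagram m n) (b : Diagram m' n')
    (f : Fin (m + m') → ZMod 2) (g : Fin (n + n') → ZMod 2) :
    mat (dtensor a b) f g =
      mat a (fun i => f (Fin.castAdd m' i)) (fun i => g (Fin.castAdd n' i)) *
      mat b (fun i => f (Fin.natAdd m i)) (fun i => g (Fin.natAdd n i)) := by
  simp only [mat, compat_dtensor, ite_and, mul_ite, mul_one, mul_zero]
  split_ifs <;> rfl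

/-- Splitting a sum over colourings of `m + n` points. -/
theorem sum_colouring_add {m n : ℕ} {M : Type} [AddCommMonoid M]
    (φ : (Fin m → ZMod 2) → (Fin n → ZMod 2) → M) :
    ∑ f : Fin (m + n) → ZMod 2, φ (fun i => f (Fin.castAdd n i)) (fun i => f (Fin.natAdd m i)) =
      ∑ f, ∑ g, φ f g := by
  rw [← Fintype.sum_prod_type']
  refine Fintype.sum_equiv (Fin.appendEquiv m n).symm _ _ fun f => ?_
  simp [Fin.appendEquiv]

theorem mat_mul_mat_dtensor {l m n l' m' n' : ℕ} (a : Diagram l m) (b : Diagram m n)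
    (a' : Diagram l' m') (b' : Diagram m' n') (f : Fin (l + l') → ZMod 2)
    (h : Fin (n + n') → ZMod 2) :
    (mat (dtensor a a') * mat (dtensor b b')) f h =
      (mat a * mat b) (fun i => f (Fin.castAdd l' i)) (fun i => h (Fin.castAdd n' i)) *
      (mat a' * mat b') (fun i => f (Fin.natAdd l i)) (fun i => h (Fin.natAdd n i)) := by
  simp only [Matrix.mul_apply, mat_dtensor]
  rw [sum_colouring_add (m := m) (n := m') (fun g g' =>
    mat a (fun i => f (Fin.castAdd l' i)) g * mat a' (fun i => f (Fin.natAdd l i)) g' *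
    (mat b g (fun i => h (Fin.castAdd n' i)) * mat b' g' (fun i => h (Fin.natAdd n i)))),
    Finset.sum_mul_sum]
  exact Finset.sum_congr rfl fun _ _ => Finset.sum_congr rfl fun _ _ => by ring

/-- The interchange law. -/
theorem tensor_comp {d : K} {l m n l' m' n' : ℕ} (b : Hom K m n) (a : Hom K l m)
    (b' : Hom K m' n') (a' : Hom K l' m') :
    tensor (comp d b a) (comp d b' a') = comp d (tensor b b') (tensor a a') := by
  induction a using hom_induction with
  | h0 => simp only [comp_zero, zero_tensor]
  | hadd x y hx hy => simp only [comp_add, add_tensor, hx, hy]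
  | hs r a =>
  simp only [comp_smul, smul_tensor]
  congr 1
  induction a' using hom_induction with
  | h0 => simp only [comp_zero, tensor_zero]
  | hadd x y hx hy => simp only [comp_add, tensor_add, hx, hy]
  | hs r a' =>
  simp only [comp_smul, tensor_smul]
  congr 1
  induction b using hom_induction with
  | h0 => simp only [zero_comp, zero_tensor]
  | hadd x y hx hy => simp only [add_comp, add_tensor, hx, hy]
  | hs r b =>
  simp only [smul_comp, smul_tensor]
  congr 1
  induction b' using hom_induction with
  | h0 => simp only [zero_comp, tensor_zero, zero_comp]
  | hadd x y hx hy => simp only [add_comp, tensor_add, hx, hy]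
  | hs r b' =>
  simp only [smul_comp, tensor_smul]
  congr 1
  simp only [tensor_single, comp_single, smul_tensor, tensor_smul]
  have key : 2 ^ (numLoops a b + numLoops a' b') • mat (dtensor (dcomp b a) (dcomp b' a')) =
      2 ^ numLoops (dtensor a a') (dtensor b b') •
        mat (dcomp (dtensor b b') (dtensor a a')) := by
    rw [← mat_mul_mat]
    ext f h
    rw [mat_mul_mat_dtensor, mat_mul_mat, mat_mul_mat]
    simp only [Matrix.smul_apply, mat_dtensor, smul_eq_mul]
    ring
  obtain ⟨h1, h2⟩ := pow_smul_mat_injective key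
  rw [← h1, ← h2, smul_smul, pow_add, mul_comm]

/-- Adding a vertical strand on the right. -/
noncomputable def addStrand {m n : ℕ} (x : Hom K m n) : Hom K (m + 1) (n + 1) :=
  tensor x (idHom K 1)

theorem dtensor_idD (m n : ℕ) : dtensor (idD m) (idD n) = idD (m + n) := by
  refine Diagram.ext_compat fun F hF => ?_
  obtain ⟨f, g, rfl⟩ : ∃ f h, F = Sum.elim f h := ⟨_, _, (Sum.elim_comp_inl_inr F).symm⟩
  rw [compat_dtensor, compat_idD, compat_idD] at hF
  rw [compat_idD]
  funext i
  refine Fin.addCases (fun i => ?_) (fun i => ?_) i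
  · exact congrFun hF.1 i
  · exact congrFun hF.2 i

theorem tensor_idHom (m n : ℕ) : tensor (idHom K m) (idHom K n) = idHom K (m + n) := by
  simp only [idHom_eq_single, tensor_single, dtensor_idD]

theorem dtensor_idD_zero {m n : ℕ} (a : Diagram m n) : dtensor a (idD 0) = a := by
  refine Diagram.ext_compat fun F hF => ?_
  obtain ⟨f, g, rfl⟩ : ∃ f h, F = Sum.elim f h := ⟨_, _, (Sum.elim_comp_inl_inr F).symm⟩
  rw [compat_dtensor] at hF
  exact hF.1

theorem tensor_idHom_zero {m n : ℕ} (x : Hom K m n) : tensor x (idHom K 0) = x := by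
  induction x using hom_induction with
  | h0 => exact zero_tensor _
  | hadd x y hx hy => rw [add_tensor, hx, hy]
  | hs r a => rw [smul_tensor, idHom_eq_single, tensor_single, dtensor_idD_zero]

/-- Transport of morphisms along equalities of the numbers of points. -/
def castHom {m n m' n' : ℕ} (hm : m = m') (hn : n = n') (x : Hom K m n) : Hom K m' n' :=
  hm ▸ hn ▸ x

/-- Transport of diagrams along equalities of the numbers of points. -/
def castDiagram {m n m' n' : ℕ} (hm : m = m') (hn : n = n') (a : Diagram m n) : Diagram m' n' :=
  hm ▸ hn ▸ a

theorem castHom_single {m n m' n' : ℕ} (hm : m = m') (hn : n = n') (a : Diagram m n) :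
    castHom hm hn (single a : Hom K m n) = single (castDiagram hm hn a) := by
  subst hm hn; rfl

theorem castHom_add {m n m' n' : ℕ} (hm : m = m') (hn : n = n') (x y : Hom K m n) :
    castHom hm hn (x + y) = castHom hm hn x + castHom hm hn y := by
  subst hm hn; rfl

theorem castHom_smul {m n m' n' : ℕ} (hm : m = m') (hn : n = n') (r : K) (x : Hom K m n) :
    castHom hm hn (r • x) = r • castHom hm hn x := by
  subst hm hn; rfl

theorem castHom_zero {m n m' n' : ℕ} (hm : m = m') (hn : n = n') :
    castHom hm hn (0 : Hom K m n) = 0 := by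
  subst hm hn; rfl

theorem compat_castDiagram {m n m' n' : ℕ} (hm : m = m') (hn : n = n') (a : Diagram m n)
    (f : Fin m' → ZMod 2) (g : Fin n' → ZMod 2) :
    Compat (castDiagram hm hn a) (Sum.elim f g) ↔
      Compat a (Sum.elim (fun i => f (Fin.cast hm i)) (fun i => g (Fin.cast hn i))) := by
  subst hm hn; rfl

theorem dtensor_assoc {m n m' n' p q : ℕ} (a : Diagram m n) (b : Diagram m' n')
    (c : Diagram p q) : castDiagram (Nat.add_assoc m m' p) (Nat.add_assoc n n' q)
      (dtensor (dtensor a b) c) = dtensor a (dtensor b c) := by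
  refine Diagram.ext_compat fun F hF => ?_
  obtain ⟨f, g, rfl⟩ : ∃ f h, F = Sum.elim f h := ⟨_, _, (Sum.elim_comp_inl_inr F).symm⟩
  rw [compat_castDiagram, compat_dtensor, compat_dtensor, and_assoc] at hF
  rw [compat_dtensor, compat_dtensor]
  refine ⟨hF.1, hF.2.1, ?_⟩
  convert hF.2.2 using 5 <;> exact Fin.ext (by simp [Nat.add_assoc])

theorem tensor_assoc {m n m' n' p q : ℕ} (x : Hom K m n) (y : Hom K m' n') (z : Hom K p q) :
    castHom (Nat.add_assoc m m' p) (Nat.add_assoc n n' q) (tensor (tensor x y) z) =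
      tensor x (tensor y z) := by
  induction x using hom_induction with
  | h0 => simp only [zero_tensor, castHom_zero]
  | hadd x y hx hy => simp only [add_tensor, castHom_add, hx, hy]
  | hs r a =>
  simp only [smul_tensor, castHom_smul]
  congr 1
  induction y using hom_induction with
  | h0 => simp only [zero_tensor, tensor_zero, castHom_zero]
  | hadd x y hx hy => simp only [add_tensor, tensor_add, castHom_add, hx, hy]
  | hs r b =>
  simp only [smul_tensor, tensor_smul, castHom_smul]
  congr 1
  induction z using hom_induction with
  | h0 => simp only [tensor_zero, castHom_zero]
  | hadd x y hx hy => simp only [tensor_add, castHom_add, hx, hy]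
  | hs r c =>
  simp only [tensor_smul, castHom_smul]
  congr 1
  simp only [tensor_single, castHom_single, dtensor_assoc]

theorem addStrand_tensor {m n m' n' : ℕ} (x : Hom K m n) (y : Hom K m' n') :
    addStrand (tensor x y) = (tensor x (addStrand y) : Hom K (m + (m' + 1)) (n + (n' + 1))) :=
  tensor_assoc x y (idHom K 1)

theorem addStrand_comp {d : K} {l m n : ℕ} (b : Hom K m n) (a : Hom K l m) :
    addStrand (comp d b a) = comp d (addStrand b) (addStrand a) := by
  rw [addStrand, addStrand, addStrand, ← tensor_comp, id_comp]

theorem addStrand_idHom (n : ℕ) : addStrand (idHom K n) = idHom K (n + 1) := tensor_idHom n 1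

/-- The morphism `1_n ⊗ ∩`. -/
noncomputable def capR (K : Type) [Field K] (n : ℕ) : Hom K n (n + 2) :=
  tensor (idHom K n) (capHom K)

/-- The morphism `1_n ⊗ ∪`. -/
noncomputable def cupR (K : Type) [Field K] (n : ℕ) : Hom K (n + 2) n :=
  tensor (idHom K n) (cupHom K)

theorem addStrand_addStrand {m n : ℕ} (x : Hom K m n) :
    addStrand (addStrand x) = tensor x (idHom K 2) := by
  have h : addStrand (tensor x (idHom K 1)) = tensor x (idHom K 2) := by
    rw [addStrand_tensor, addStrand_idHom]
  exact h

theorem addStrand_addStrand_comp_capR {d : K} {m n : ℕ} (x : Hom K m n) :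
    comp d (addStrand (addStrand x)) (capR K m) = comp d (capR K n) x := by
  rw [addStrand_addStrand, capR, ← tensor_comp, comp_id, id_comp, capR]
  conv_rhs => rw [← tensor_idHom_zero x]
  exact (congrArg₂ tensor (id_comp x).symm (comp_id (capHom K)).symm).trans
    (tensor_comp (idHom K n) x (capHom K) (idHom K 0))

theorem cupR_comp_addStrand_addStrand {d : K} {m n : ℕ} (x : Hom K m n) :
    comp d (cupR K n) (addStrand (addStrand x)) = comp d x (cupR K m) := by
  rw [addStrand_addStrand, cupR, ← tensor_comp, comp_id, id_comp, cupR]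
  conv_rhs => rw [← tensor_idHom_zero x]
  exact (congrArg₂ tensor (comp_id x).symm (id_comp (cupHom K)).symm).trans
    (tensor_comp x (idHom K m) (idHom K 0) (cupHom K))

theorem compat_capD {f : Fin 0 → ZMod 2} {g : Fin 2 → ZMod 2} :
    Compat capD (Sum.elim f g) ↔ g 0 = g 1 := by
  constructor
  · intro h
    exact (h (Sum.inr 0)).symm
  · rintro h (x | x)
    · exact x.elim0
    · fin_cases x
      · exact h.symm
      · exact h

theorem compat_cupD {f : Fin 2 → ZMod 2} {g : Fin 0 → ZMod 2} :
    Compat cupD (Sum.elim f g) ↔ f 0 = f 1 := by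
  constructor
  · intro h
    exact (h (Sum.inl 0)).symm
  · rintro h (x | x)
    · fin_cases x
      · exact h.symm
      · exact h
    · exact x.elim0

theorem capHom_eq_single : capHom K = single capD := rfl

theorem cupHom_eq_single : cupHom K = single cupD := rfl

theorem cupHom_comp_capHom (d : K) : comp d (cupHom K) (capHom K) = d • idHom K 0 := by
  rw [cupHom_eq_single, capHom_eq_single, comp_single]
  have h : numLoops capD cupD = 1 := by
    refine Nat.pow_right_injective le_rfl ((card_inner capD cupD).symm.trans ?_)
    rw [Nat.card_eq_fintype_card, Fintype.card_subtype]
    simp only [Inner, compat_capD, compat_cupD, and_self]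
    decide
  have h2 : dcomp cupD capD = idD 0 := by
    refine Diagram.ext_pair (funext fun x => ?_)
    rcases x with x | x <;> exact x.elim0
  rw [h, h2, pow_one, idHom_eq_single]

theorem cupR_comp_capR (d : K) (n : ℕ) : comp d (cupR K n) (capR K n) = d • idHom K n := by
  rw [cupR, capR, ← tensor_comp, id_comp, cupHom_comp_capHom, tensor_smul]
  exact congrArg (d • ·) (tensor_idHom_zero _)

theorem snake_left (d : K) :
    comp d (addStrand (cupHom K) : Hom K 3 1) (tensor (idHom K 1) (capHom K) : Hom K 1 3) =
      idHom K 1 := by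
  rw [addStrand, cupHom_eq_single, capHom_eq_single, idHom_eq_single, tensor_single,
    tensor_single]
  refine comp_single_of_unique (fun f h => ?_) fun g hg => ?_
  · revert f h
    simp only [compat_dtensor, compat_capD, compat_cupD, compat_idD]
    decide
  · revert hg g
    simp only [Inner, compat_dtensor, compat_capD, compat_cupD, compat_idD]
    decide

theorem snake_right (d : K) :
    comp d (tensor (idHom K 1) (cupHom K) : Hom K 3 1) (addStrand (capHom K) : Hom K 1 3) =
      idHom K 1 := by
  rw [addStrand, cupHom_eq_single, capHom_eq_single, idHom_eq_single, tensor_single,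
    tensor_single]
  refine comp_single_of_unique (fun f h => ?_) fun g hg => ?_
  · revert f h
    simp only [compat_dtensor, compat_capD, compat_cupD, compat_idD]
    decide
  · revert hg g
    simp only [Inner, compat_dtensor, compat_capD, compat_cupD, compat_idD]
    decide

theorem tensor_idHom_succ {m n : ℕ} (k : ℕ) (x : Hom K m n) :
    castHom (by omega) (by omega) (tensor (idHom K (k + 1)) x) =
      tensor (idHom K k) (tensor (idHom K 1) x) := by
  rw [← tensor_idHom, tensor_assoc]

theorem capR_succ (n : ℕ) :
    capR K (n + 1) = tensor (idHom K n) (tensor (idHom K 1) (capHom K)) :=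
  tensor_idHom_succ n (capHom K)

theorem cupR_succ (n : ℕ) :
    cupR K (n + 1) = tensor (idHom K n) (tensor (idHom K 1) (cupHom K)) :=
  tensor_idHom_succ n (cupHom K)

theorem addStrand_cupR_comp_capR (d : K) (n : ℕ) :
    comp d (addStrand (cupR K n)) (capR K (n + 1)) = idHom K (n + 1) := by
  rw [capR_succ, cupR, addStrand_tensor]
  refine (tensor_comp (d := d) (idHom K n) (idHom K n) (addStrand (cupHom K) : Hom K 3 1)
    (tensor (idHom K 1) (capHom K) : Hom K 1 3)).symm.trans ?_
  rw [id_comp]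
  exact (congrArg (tensor (idHom K n)) (snake_left d)).trans (tensor_idHom n 1)

theorem cupR_comp_addStrand_capR (d : K) (n : ℕ) :
    comp d (cupR K (n + 1)) (addStrand (capR K n)) = idHom K (n + 1) := by
  rw [cupR_succ, capR, addStrand_tensor]
  refine (tensor_comp (d := d) (idHom K n) (idHom K n) (tensor (idHom K 1) (cupHom K) : Hom K 3 1)
    (addStrand (capHom K) : Hom K 1 3)).symm.trans ?_
  rw [id_comp]
  exact (congrArg (tensor (idHom K n)) (snake_right d)).trans (tensor_idHom n 1)

/-! ### The diagrams `E_i` -/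

theorem eiPair_inl {n i : ℕ} (h : i + 2 ≤ n) (j : Fin n) : eiPair n i (Sum.inl j) =
    if (j : ℕ) = i then Sum.inl ⟨i + 1, h⟩ else
    if (j : ℕ) = i + 1 then Sum.inl ⟨i, by omega⟩ else Sum.inr j := by
  simp only [eiPair]
  split_ifs with h1 h2
  · exact congrArg _ (Fin.ext (by simp only [h1]; exact Nat.mod_eq_of_lt h))
  · exact congrArg _ (Fin.ext (by simp only [h2]; omega))
  · rfl

theorem eiPair_inr {n i : ℕ} (h : i + 2 ≤ n) (j : Fin n) : eiPair n i (Sum.inr j) =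
    if (j : ℕ) = i then Sum.inr ⟨i + 1, h⟩ else
    if (j : ℕ) = i + 1 then Sum.inr ⟨i, by omega⟩ else Sum.inl j := by
  simp only [eiPair]
  split_ifs with h1 h2
  · exact congrArg _ (Fin.ext (by simp only [h1]; exact Nat.mod_eq_of_lt h))
  · exact congrArg _ (Fin.ext (by simp only [h2]; omega))
  · rfl

/-- The diagram `E_i`. -/
def eiD (n i : ℕ) (h : i + 2 ≤ n) : Diagram n n where
  pair := eiPair n i
  involutive := by
    rintro (⟨j, hj⟩ | ⟨j, hj⟩)
    · rw [eiPair_inl h]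
      split_ifs with h1 h2
      · rw [eiPair_inl h]; simp_all
      · rw [eiPair_inl h]; simp_all
      · rw [eiPair_inr h]; simp_all
    · rw [eiPair_inr h]
      split_ifs with h1 h2
      · rw [eiPair_inr h]; simp_all
      · rw [eiPair_inr h]; simp_all
      · rw [eiPair_inl h]; simp_all
  fixedPointFree := by
    rintro (⟨j, hj⟩ | ⟨j, hj⟩)
    · rw [eiPair_inl h]
      split_ifs with h1 h2 <;> simp_all
    · rw [eiPair_inr h]
      split_ifs with h1 h2 <;> simp_all
  noncrossing := by
    rintro (⟨j, hj⟩ | ⟨j, hj⟩) (⟨k, hk⟩ | ⟨k, hk⟩)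
    · rw [eiPair_inl h, eiPair_inl h]
      split_ifs <;> simp_all [bIdx] <;> omega
    · rw [eiPair_inl h, eiPair_inr h]
      split_ifs <;> simp_all [bIdx] <;> omega
    · rw [eiPair_inr h, eiPair_inl h]
      split_ifs <;> simp_all [bIdx] <;> omega
    · rw [eiPair_inr h, eiPair_inr h]
      split_ifs <;> simp_all [bIdx] <;> omega

theorem eiD_pair {n i : ℕ} (h : i + 2 ≤ n) : (eiD n i h).pair = eiPair n i := rfl

theorem EHom_eq_single {n i : ℕ} (h : i + 2 ≤ n) : EHom K n i = single (eiD n i h) := by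
  funext c
  have : c.pair = eiPair n i ↔ c = eiD n i h :=
    ⟨fun e => Diagram.ext_pair e, fun e => by rw [e]; rfl⟩
  simp only [EHom, single, this]

theorem compat_eiD {n i : ℕ} (h : i + 2 ≤ n) (f g : Fin n → ZMod 2) :
    Compat (eiD n i h) (Sum.elim f g) ↔ f ⟨i, by omega⟩ = f ⟨i + 1, h⟩ ∧
      g ⟨i, by omega⟩ = g ⟨i + 1, h⟩ ∧ ∀ j : Fin n, (j : ℕ) ≠ i → (j : ℕ) ≠ i + 1 → f j = g j := by
  constructor
  · intro hc
    refine ⟨?_, ?_, fun j h1 h2 => ?_⟩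
    · have := hc (Sum.inl ⟨i, by omega⟩)
      rw [eiD_pair, eiPair_inl h] at this
      simpa using this.symm
    · have := hc (Sum.inr ⟨i, by omega⟩)
      rw [eiD_pair, eiPair_inr h] at this
      simpa using this.symm
    · have := hc (Sum.inl j)
      rw [eiD_pair, eiPair_inl h] at this
      simpa [h1, h2] using this.symm
  · rintro ⟨h1, h2, h3⟩ (⟨j, hj⟩ | ⟨j, hj⟩)
    · rw [eiD_pair, eiPair_inl h]
      split_ifs with h4 h5
      · simp only at h4; subst h4; exact h1.symm
      · simp only at h5; subst h5; exact h1
      · exact (h3 _ h4 h5).symm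
    · rw [eiD_pair, eiPair_inr h]
      split_ifs with h4 h5
      · simp only at h4; subst h4; exact h2.symm
      · simp only at h5; subst h5; exact h2
      · exact h3 _ h4 h5

theorem addStrand_EHom {n i : ℕ} (h : i + 2 ≤ n) :
    addStrand (EHom K n i) = EHom K (n + 1) i := by
  rw [EHom_eq_single h, EHom_eq_single (h.trans n.le_succ), addStrand, idHom_eq_single,
    tensor_single]
  congr 1
  refine Diagram.ext_compat fun F hF => ?_
  obtain ⟨f, g, rfl⟩ : ∃ f h, F = Sum.elim f h := ⟨_, _, (Sum.elim_comp_inl_inr F).symm⟩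
  rw [compat_dtensor, compat_idD, compat_eiD] at hF
  obtain ⟨⟨h1, h2, h3⟩, h4⟩ := hF
  rw [compat_eiD]
  refine ⟨h1, h2, fun j => ?_⟩
  refine Fin.addCases (fun j => ?_) (fun j => ?_) j
  · exact h3 j
  · exact fun _ _ => congrFun h4 j

theorem EHom_last (d : K) (k : ℕ) : EHom K (k + 2) k = comp d (capR K k) (cupR K k) := by
  have h0 : comp d (capHom K) (cupHom K) = single (eiD 2 0 le_rfl) := by
    rw [capHom_eq_single, cupHom_eq_single]
    refine comp_single_of_unique (fun f h => ?_) fun g hg => funext fun i => i.elim0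
    simp only [compat_cupD, compat_capD, compat_eiD]
    constructor
    · exact fun ⟨h1, h2, _⟩ => ⟨0, h1, h2⟩
    · exact fun ⟨_, h1, h2⟩ => ⟨h1, h2, fun j h3 h4 => by omega⟩
  rw [capR, cupR, ← tensor_comp, h0, comp_id, EHom_eq_single le_rfl, idHom_eq_single,
    tensor_single]
  congr 1
  symm
  refine Diagram.ext_compat fun F hF => ?_
  obtain ⟨f, g, rfl⟩ : ∃ f h, F = Sum.elim f h := ⟨_, _, (Sum.elim_comp_inl_inr F).symm⟩
  rw [compat_dtensor, compat_idD, compat_eiD] at hF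
  obtain ⟨h4, h1, h2, -⟩ := hF
  rw [compat_eiD]
  refine ⟨h1, h2, fun j => ?_⟩
  refine Fin.addCases (fun j => ?_) (fun j => ?_) j
  · exact fun _ _ => congrFun h4 j
  · intro h5 h6
    simp only [Fin.val_natAdd] at h5 h6
    omega

/-- The colourings of the points `i`, `i + 1` by a common colour. -/
theorem card_supported_pair {n i : ℕ} (h : i + 2 ≤ n) :
    Nat.card {g : Fin n → ZMod 2 // g ⟨i, by omega⟩ = g ⟨i + 1, h⟩ ∧
      ∀ j : Fin n, (j : ℕ) ≠ i → (j : ℕ) ≠ i + 1 → g j = 0} = 2 := by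
  refine Eq.trans (Nat.card_congr ⟨fun g => g.1 ⟨i, by omega⟩,
    fun c => ⟨fun j => if (j : ℕ) = i ∨ (j : ℕ) = i + 1 then c else 0, ?_⟩, fun g => ?_,
    fun c => ?_⟩) (Nat.card_zmod 2)
  · simp +contextual
  · refine Subtype.ext (funext fun j => ?_)
    simp only
    split_ifs with h1
    · rcases h1 with h1 | h1
      · exact congrArg g.1 (Fin.ext h1.symm)
      · exact g.2.1.trans (congrArg g.1 (Fin.ext h1.symm))
    · rw [not_or] at h1
      exact (g.2.2 j h1.1 h1.2).symm
  · simp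

theorem compat_supported_top {n m i : ℕ} (h : i + 2 ≤ n) {b : Diagram n m}
    (hb : b.pair (Sum.inl ⟨i, by omega⟩) = Sum.inl ⟨i + 1, h⟩) {g : Fin n → ZMod 2}
    (h1 : g ⟨i, by omega⟩ = g ⟨i + 1, h⟩)
    (h2 : ∀ j : Fin n, (j : ℕ) ≠ i → (j : ℕ) ≠ i + 1 → g j = 0) : Compat b (Sum.elim g 0) := by
  have hb' : b.pair (Sum.inl ⟨i + 1, h⟩) = Sum.inl ⟨i, by omega⟩ := by
    rw [← hb, b.involutive]
  have h0 : ∀ x, x ≠ Sum.inl ⟨i, by omega⟩ → x ≠ Sum.inl ⟨i + 1, h⟩ →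
      (Sum.elim g 0 : Fin n ⊕ Fin m → ZMod 2) x = 0 := by
    rintro (x | x) h3 h4
    · exact h2 x (fun e => h3 (congrArg _ (Fin.ext e))) (fun e => h4 (congrArg _ (Fin.ext e)))
    · rfl
  intro x
  by_cases hx : x = Sum.inl ⟨i, by omega⟩
  · rw [hx, hb]; exact h1.symm
  by_cases hx' : x = Sum.inl ⟨i + 1, h⟩
  · rw [hx', hb']; exact h1
  rw [h0 x hx hx', h0 (b.pair x)]
  · exact fun e => hx' (by rw [← hb, ← e, b.involutive])
  · exact fun e => hx (by rw [← hb', ← e, b.involutive])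

theorem compat_supported_bottom {n m i : ℕ} (h : i + 2 ≤ n) {b : Diagram m n}
    (hb : b.pair (Sum.inr ⟨i, by omega⟩) = Sum.inr ⟨i + 1, h⟩) {g : Fin n → ZMod 2}
    (h1 : g ⟨i, by omega⟩ = g ⟨i + 1, h⟩)
    (h2 : ∀ j : Fin n, (j : ℕ) ≠ i → (j : ℕ) ≠ i + 1 → g j = 0) : Compat b (Sum.elim 0 g) := by
  have hb' : b.pair (Sum.inr ⟨i + 1, h⟩) = Sum.inr ⟨i, by omega⟩ := by
    rw [← hb, b.involutive]
  have h0 : ∀ x, x ≠ Sum.inr ⟨i, by omega⟩ → x ≠ Sum.inr ⟨i + 1, h⟩ →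
      (Sum.elim 0 g : Fin m ⊕ Fin n → ZMod 2) x = 0 := by
    rintro (x | x) h3 h4
    · rfl
    · exact h2 x (fun e => h3 (congrArg _ (Fin.ext e))) (fun e => h4 (congrArg _ (Fin.ext e)))
  intro x
  by_cases hx : x = Sum.inr ⟨i, by omega⟩
  · rw [hx, hb]; exact h1.symm
  by_cases hx' : x = Sum.inr ⟨i + 1, h⟩
  · rw [hx', hb']; exact h1
  rw [h0 x hx hx', h0 (b.pair x)]
  · exact fun e => hx' (by rw [← hb, ← e, b.involutive])
  · exact fun e => hx (by rw [← hb', ← e, b.involutive])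

theorem comp_EHom_of_cup (d : K) {n m i : ℕ} (h : i + 2 ≤ n) {b : Diagram n m}
    (hb : b.pair (Sum.inl ⟨i, by omega⟩) = Sum.inl ⟨i + 1, h⟩) :
    comp d (single b) (EHom K n i) = d • single b := by
  rw [EHom_eq_single h, comp_single]
  have h1 : dcomp b (eiD n i h) = b := by
    refine Diagram.ext_compat fun F hF => ?_
    obtain ⟨f, g, rfl⟩ : ∃ f h, F = Sum.elim f h := ⟨_, _, (Sum.elim_comp_inl_inr F).symm⟩
    obtain ⟨g', h1, h2⟩ := compat_dcomp.1 hF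
    rw [compat_eiD] at h1
    have := h2.add (compat_supported_top h hb (g := f - g')
      (by simp [h1.1, h1.2.1]) (fun j h3 h4 => by simp [h1.2.2 j h3 h4]))
    rwa [elim_add_elim, add_sub_cancel, add_zero] at this
  have h2 : numLoops (eiD n i h) b = 1 := by
    refine Nat.pow_right_injective le_rfl ((card_inner _ _).symm.trans ?_)
    refine Eq.trans ?_ (card_supported_pair h)
    refine Nat.card_congr (Equiv.subtypeEquivRight fun g => ?_)
    rw [Inner, compat_eiD]
    constructor
    · exact fun h => ⟨h.1.2.1, fun j h3 h4 => (h.1.2.2 j h3 h4).symm⟩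
    · exact fun h' => ⟨⟨rfl, h'.1, fun j h3 h4 => (h'.2 j h3 h4).symm⟩,
        compat_supported_top h hb h'.1 h'.2⟩
  rw [h1, h2, pow_one]

theorem EHom_comp_of_cap (d : K) {n m i : ℕ} (h : i + 2 ≤ n) {b : Diagram m n}
    (hb : b.pair (Sum.inr ⟨i, by omega⟩) = Sum.inr ⟨i + 1, h⟩) :
    comp d (EHom K n i) (single b) = d • single b := by
  rw [EHom_eq_single h, comp_single]
  have h1 : dcomp (eiD n i h) b = b := by
    refine Diagram.ext_compat fun F hF => ?_
    obtain ⟨f, g, rfl⟩ : ∃ f h, F = Sum.elim f h := ⟨_, _, (Sum.elim_comp_inl_inr F).symm⟩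
    obtain ⟨g', h1, h2⟩ := compat_dcomp.1 hF
    rw [compat_eiD] at h2
    have := h1.add (compat_supported_bottom h hb (g := g - g')
      (by simp [h2.1, h2.2.1]) (fun j h3 h4 => by simp [h2.2.2 j h3 h4]))
    rwa [elim_add_elim, add_sub_cancel, add_zero] at this
  have h2 : numLoops b (eiD n i h) = 1 := by
    refine Nat.pow_right_injective le_rfl ((card_inner _ _).symm.trans ?_)
    refine Eq.trans ?_ (card_supported_pair h)
    refine Nat.card_congr (Equiv.subtypeEquivRight fun g => ?_)
    rw [Inner, compat_eiD]
    constructor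
    · exact fun h => ⟨h.2.1, h.2.2.2⟩
    · exact fun h' => ⟨compat_supported_bottom h hb h'.1 h'.2, h'.1, rfl, h'.2⟩
  rw [h1, h2, pow_one]

/-! ### The Markov trace and partial traces -/

/-- The diagram `1_n ⊗ ∩`. -/
def capRD (n : ℕ) : Diagram n (n + 2) := dtensor (idD n) capD

/-- The diagram `1_n ⊗ ∪`. -/
def cupRD (n : ℕ) : Diagram (n + 2) n := dtensor (idD n) cupD

theorem capR_eq_single (n : ℕ) : capR K n = single (capRD n) := tensor_single (idD n) capD

theorem cupR_eq_single (n : ℕ) : cupR K n = single (cupRD n) := tensor_single (idD n) cupD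

theorem exists_Tr_comp_single {m n : ℕ} (b : Diagram n m) (a : Diagram m n) :
    ∃ N : ℕ, (mat a * mat b).trace = 2 ^ N ∧
      ∀ (K : Type) [Field K] (d : K), Tr d (comp d (single b) (single a)) = d ^ N := by
  refine ⟨numLoops a b + trLoops (dcomp b a), ?_, fun K _ d => ?_⟩
  · rw [mat_mul_mat, Matrix.trace_smul, trace_mat, smul_eq_mul, pow_add]
  · rw [comp_single, Tr_smul, Tr_single, pow_add]

theorem sum_mat_capR {n : ℕ} (h : Fin n → ZMod 2) (φ : (Fin (n + 1 + 1) → ZMod 2) → ℕ) :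
    ∑ f : Fin (n + 1 + 1) → ZMod 2, mat (capRD n) h f * φ f =
      ∑ t : ZMod 2, φ (Fin.snoc (α := fun _ => ZMod 2) (Fin.snoc (α := fun _ => ZMod 2) h t) t) := by
  have h1 : ∀ f : Fin (n + 1 + 1) → ZMod 2,
      mat (capRD n) h f =
        if (∃ t, f = Fin.snoc (α := fun _ => ZMod 2) (Fin.snoc (α := fun _ => ZMod 2) h t) t)
          then 1 else 0 := by
    intro f
    refine if_congr ?_ rfl rfl
    refine compat_dtensor.trans ?_
    rw [compat_idD, compat_capD]
    constructor
    · rintro ⟨h1, h2⟩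
      refine ⟨f (Fin.last _), ?_⟩
      funext j
      refine Fin.lastCases ?_ (fun j => ?_) j
      · simp
      · rw [Fin.snoc_castSucc]
        refine Fin.lastCases ?_ (fun j => ?_) j
        · rw [Fin.snoc_last]; exact h2
        · rw [Fin.snoc_castSucc]; exact (congrFun h1 j).symm
    · rintro ⟨t, rfl⟩
      refine ⟨funext fun j => ?_, ?_⟩
      · have : (Fin.castAdd 2 j : Fin (n + 2)) = Fin.castSucc (Fin.castSucc j) := rfl
        rw [this, Fin.snoc_castSucc, Fin.snoc_castSucc]
        rfl
      · have h2 : (Fin.natAdd n (0 : Fin 2) : Fin (n + 2)) = Fin.castSucc (Fin.last n) := rfl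
        have h3 : (Fin.natAdd n (1 : Fin 2) : Fin (n + 2)) = Fin.last (n + 1) := rfl
        rw [h2, h3, Fin.snoc_castSucc, Fin.snoc_last, Fin.snoc_last]
  simp only [h1, ite_mul, one_mul, zero_mul]
  rw [← Finset.sum_filter]
  refine Finset.sum_nbij' (fun f => f (Fin.last _))
    (fun t => Fin.snoc (α := fun _ => ZMod 2) (Fin.snoc (α := fun _ => ZMod 2) h t) t) ?_ ?_ ?_ ?_ ?_
  · simp
  · simp
  · simp
  · simp
  · simp

theorem mat_cupR {n : ℕ} (h : Fin n → ZMod 2) (f : Fin (n + 2) → ZMod 2) :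
    mat (cupRD n) f h = mat (capRD n) h f := by
  refine if_congr ?_ rfl rfl
  refine compat_dtensor.trans (Iff.trans ?_ compat_dtensor.symm)
  rw [compat_idD, compat_idD, compat_capD, compat_cupD]
  exact and_congr_left' eq_comm

theorem trace_close_last {n : ℕ} (x : Diagram (n + 1) (n + 1)) :
    (mat (capRD n) * mat (dtensor x (idD 1)) * mat (cupRD n)).trace = (mat x).trace := by
  have h1 : ∀ (f g : Fin n → ZMod 2) (t s : ZMod 2), mat (dtensor x (idD 1))
      (Fin.snoc (α := fun _ => ZMod 2) (Fin.snoc (α := fun _ => ZMod 2) f t) t)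
      (Fin.snoc (α := fun _ => ZMod 2) (Fin.snoc (α := fun _ => ZMod 2) g s) s) =
      if t = s then mat x (Fin.snoc (α := fun _ => ZMod 2) f t)
        (Fin.snoc (α := fun _ => ZMod 2) g s) else 0 := by
    intro f g t s
    rw [mat_dtensor, mat_idD, Matrix.one_apply, mul_ite, mul_one, mul_zero]
    refine if_congr ?_ ?_ rfl
    · have e : ∀ i : Fin 1, Fin.natAdd (n + 1) i = Fin.last (n + 1) := fun i => by
        rw [Subsingleton.elim i 0]; rfl
      simp only [e, Fin.snoc_last]
      exact ⟨fun h => congrFun h 0, fun h => funext fun _ => h⟩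
    · have e : ∀ i : Fin (n + 1), Fin.castAdd 1 i = Fin.castSucc i := fun i => rfl
      simp only [e, Fin.snoc_castSucc]
  simp only [Matrix.trace, Matrix.diag, Matrix.mul_assoc]
  simp only [Matrix.mul_apply, mat_cupR, mul_comm (mat (dtensor x (idD 1)) _ _)]
  simp only [sum_mat_capR, h1, Finset.sum_ite_eq, Finset.mem_univ, if_true]
  rw [Finset.sum_comm, ← Fintype.sum_prod_type'
    (f := fun (t : ZMod 2) (h : Fin n → ZMod 2) => mat x (Fin.snoc (α := fun _ => ZMod 2) h t)
      (Fin.snoc (α := fun _ => ZMod 2) h t))]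
  exact Fintype.sum_equiv (Fin.snocEquiv fun _ => ZMod 2) _ _ fun _ => rfl

/-- Closing up the last strand preserves the Markov trace. -/
theorem Tr_close_last (d : K) {n : ℕ} (x : Hom K (n + 1) (n + 1)) :
    Tr d (comp d (cupR K n) (comp d (addStrand x) (capR K n))) = Tr d x := by
  induction x using hom_induction with
  | h0 => simp only [addStrand, zero_tensor, zero_comp, comp_zero, Tr_zero]
  | hadd x y hx hy =>
    rw [addStrand] at hx hy
    rw [addStrand, add_tensor, add_comp, comp_add, Tr_add, hx, hy, Tr_add]
  | hs r x =>
    rw [addStrand, smul_tensor, smul_comp, comp_smul, Tr_smul, Tr_smul]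
    congr 1
    rw [cupR_eq_single, capR_eq_single, idHom_eq_single, tensor_single, comp_single, comp_smul,
      Tr_smul]
    obtain ⟨N, h1, h2⟩ := exists_Tr_comp_single (cupRD n)
      (dcomp (dtensor x (idD 1) : Diagram (n + 1 + 1) (n + 1 + 1)) (capRD n))
    rw [h2, Tr_single, ← pow_add]
    congr 1
    refine Nat.pow_right_injective le_rfl ?_
    simp only
    rw [← trace_mat x, ← trace_close_last, mat_mul_mat, Matrix.smul_mul, Matrix.trace_smul, h1,
      smul_eq_mul, pow_add]

theorem addStrand_mem_Negl {d : K} {m n : ℕ} {x : Hom K m n} (hx : x ∈ Negl d m n) :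
    addStrand x ∈ Negl d (m + 1) (n + 1) := by
  intro b
  rw [← Tr_close_last, addStrand_comp, ← comp_assoc, addStrand_addStrand_comp_capR, comp_assoc,
    comp_assoc]
  exact hx _

theorem tensor_idHom_mem_Negl {d : K} {m n : ℕ} {x : Hom K m n} (hx : x ∈ Negl d m n) (k : ℕ) :
    tensor x (idHom K k) ∈ Negl d (m + k) (n + k) := by
  induction k with
  | zero => rw [tensor_idHom_zero]; exact hx
  | succ k ih =>
    have h : addStrand (tensor x (idHom K k)) = tensor x (idHom K (k + 1)) := by
      rw [addStrand_tensor, addStrand_idHom]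
    rw [← h]
    exact addStrand_mem_Negl ih

/-- The closure of the first strand of a diagram. -/
theorem exists_left_closure {n m : ℕ} (z : Diagram (1 + n) (1 + m)) :
    ∃ w : Diagram n m, ∀ f g, Compat w (Sum.elim f g) ↔ ∃ t : ZMod 2,
      Compat z (Sum.elim (Fin.append (fun _ => t) f) (Fin.append (fun _ => t) g)) := by
  have hnc : IsNC (bIdx (1 + n) (1 + m)) Set.univ z.pair := fun x _ =>
    ⟨trivial, z.involutive x, z.fixedPointFree x, fun y _ => z.noncrossing x y⟩
  have hU : ∀ i : Fin 1, Uncontracted (fun _ : Fin 1 => (Sum.inl (Fin.castAdd n 0) :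
      Fin (1 + n) ⊕ Fin (1 + m))) (fun _ => Sum.inr (Fin.castAdd m 0)) i = Set.univ := by
    intro i
    ext x
    simp [Uncontracted]
  obtain ⟨w, hw⟩ := exists_diagram_of_contract (bIdx_injective _ _) hnc
    (fun _ : Fin 1 => Sum.inl (Fin.castAdd n 0)) (fun _ => Sum.inr (Fin.castAdd m 0))
    (fun i => by rw [hU]; trivial) (fun i => by rw [hU]; trivial)
    (fun i => by
      rw [hU]
      refine ⟨by simp [bIdx], Or.inr ?_⟩
      intro x _
      have h0 := bIdx_lt x
      have h1 : bIdx (1 + n) (1 + m) (Sum.inl (Fin.castAdd n 0)) = 0 := by simp [bIdx]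
      have h2 : bIdx (1 + n) (1 + m) (Sum.inr (Fin.castAdd m 0)) = 1 + n + m := by simp [bIdx]
      omega)
    (Sum.map (Fin.natAdd 1) (Fin.natAdd 1)) (by
      ext x
      simp only [Uncontracted]
      rcases x with x | x <;> refine Fin.addCases (fun i => ?_) (fun i => ?_) x
      · simp [Subsingleton.elim i 0, Fin.ext_iff]
      · simp [Fin.ext_iff]
      · simp [Subsingleton.elim i 0, Fin.ext_iff]
      · simp [Fin.ext_iff])
    (fun x y h => by rw [bIdx_right, bIdx_right]; omega)
  refine ⟨w, fun f g => (hw _).trans ?_⟩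
  constructor
  · rintro ⟨G, h1, h2, h3⟩
    refine ⟨G (Sum.inl (Fin.castAdd n 0)), ?_⟩
    convert h3 using 1
    have e : G = Sum.elim (Fin.append (fun _ => G (Sum.inl (Fin.castAdd n 0))) f)
        (Fin.append (fun _ => G (Sum.inl (Fin.castAdd n 0))) g) := by
      funext x
      rcases x with x | x <;> refine Fin.addCases (fun i => ?_) (fun i => ?_) x
      · rw [Subsingleton.elim i 0]; simp
      · simpa using h1 (Sum.inl i)
      · rw [Subsingleton.elim i 0]; simpa using (h2 0).symm
      · simpa using h1 (Sum.inr i)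
    rw [← e]; rfl
  · rintro ⟨t, h⟩
    refine ⟨_, ?_, fun i => ?_, h⟩
    · rintro (x | x) <;> simp
    · simp

theorem exists_sum_left_closure {n m : ℕ} (z : Diagram (1 + n) (1 + m)) :
    ∃ (w : Diagram n m) (s : ℕ), ∀ f g, ∑ t : ZMod 2,
      mat z (Fin.append (fun _ => t) f) (Fin.append (fun _ => t) g) = 2 ^ s * mat w f g := by
  obtain ⟨w, hw⟩ := exists_left_closure z
  have key : ∀ f g,
      Compat z (Sum.elim (Fin.append (fun _ => 1) f) (Fin.append (fun _ => 1) g)) →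
      (Compat z (Sum.elim (Fin.append (fun _ => 0) f) (Fin.append (fun _ => 0) g)) ↔
      Compat z (Sum.elim (Fin.append (fun _ => 1) 0) (Fin.append (fun _ => 1) 0))) := by
    intro f g h1
    have e : (Sum.elim (Fin.append (fun _ => 1) f) (Fin.append (fun _ => 1) g) :
        Fin (1 + n) ⊕ Fin (1 + m) → ZMod 2) =
        Sum.elim (Fin.append (fun _ => 0) f) (Fin.append (fun _ => 0) g) +
        Sum.elim (Fin.append (fun _ => 1) 0) (Fin.append (fun _ => 1) 0) := by
      funext x
      rcases x with x | x <;> refine Fin.addCases (fun i => ?_) (fun i => ?_) x <;> simp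
    rw [e] at h1
    exact ⟨fun h => by simpa using h1.sub h, fun h => by simpa using h1.sub h⟩
  have hsum : ∀ φ : ZMod 2 → ℕ, ∑ t, φ t = φ 0 + φ 1 := fun φ => Fin.sum_univ_two φ
  have hex : ∀ p : ZMod 2 → Prop, (∃ t, p t) ↔ p 0 ∨ p 1 := fun p => Fin.exists_fin_two
  by_cases hc : Compat z (Sum.elim (Fin.append (fun _ => 1) 0) (Fin.append (fun _ => 1) 0))
  · refine ⟨w, 1, fun f g => ?_⟩
    have h01 : Compat z (Sum.elim (Fin.append (fun _ => 0) f) (Fin.append (fun _ => 0) g)) →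
        Compat z (Sum.elim (Fin.append (fun _ => 1) f) (Fin.append (fun _ => 1) g)) := by
      intro h
      convert h.add hc using 1
      funext x
      rcases x with x | x <;> refine Fin.addCases (fun i => ?_) (fun i => ?_) x <;> simp
    have h10 := fun h => (key f g h).2 hc
    simp only [hsum, mat, hw, hex]
    by_cases h0 : Compat z (Sum.elim (Fin.append (fun _ => 0) f) (Fin.append (fun _ => 0) g))
    · simp [h0, h01 h0]
    · simp [h0, mt h10 h0]
  · refine ⟨w, 0, fun f g => ?_⟩
    have h10 := fun h => mt (key f g h).1 hc
    simp only [hsum, mat, hw, hex]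
    by_cases h1 : Compat z (Sum.elim (Fin.append (fun _ => 1) f) (Fin.append (fun _ => 1) g))
    · simp [h1, h10 h1]
    · simp [h1]

theorem trace_left_closure {n m : ℕ} (z : Diagram (1 + n) (1 + m)) :
    ∃ (w : Diagram n m) (s : ℕ), ∀ x : Diagram m n,
      (mat (dtensor (idD 1) x) * mat z).trace = 2 ^ s * (mat x * mat w).trace := by
  obtain ⟨w, s, h⟩ := exists_sum_left_closure z
  refine ⟨w, s, fun x => ?_⟩
  simp only [Matrix.trace, Matrix.diag, Matrix.mul_apply, mat_dtensor, mat_idD, Matrix.one_apply]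
  have e := fun (m n : ℕ) (φ : (Fin (m + n) → ZMod 2) → ℕ) =>
    (Fintype.sum_equiv (Fin.appendEquiv m n) (fun p => φ (Fin.append p.1 p.2)) φ
      fun _ => rfl).symm.trans (Fintype.sum_prod_type' fun f g => φ (Fin.append f g))
  simp only [e, Fin.append_left, Fin.append_right, ite_mul, one_mul, zero_mul]
  have e1 : ∀ φ : (Fin 1 → ZMod 2) → ℕ, ∑ f, φ f = ∑ t : ZMod 2, φ fun _ => t := fun φ =>
    Fintype.sum_equiv (Equiv.funUnique (Fin 1) (ZMod 2)) _ _ fun f =>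
      congrArg φ (funext fun i => by simp [Subsingleton.elim i 0])
  simp only [Finset.mul_sum]
  have e2 : ∀ (f g : Fin 1 → ZMod 2) (φ : (Fin n → ZMod 2) → ℕ),
      (∑ y, if f = g then φ y else 0) = if f = g then ∑ y, φ y else 0 := fun f g φ => by
    split_ifs <;> simp
  simp only [e2, Finset.sum_ite_eq, Finset.mem_univ, if_true]
  rw [Finset.sum_comm]
  refine Finset.sum_congr rfl fun f _ => ?_
  rw [Finset.sum_comm]
  refine Finset.sum_congr rfl fun g _ => ?_
  rw [← Finset.mul_sum, e1, h]
  ring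

theorem exists_Tr_comp_idHom_tensor {n m : ℕ} (d : K) (z : Diagram (1 + n) (1 + m)) :
    ∃ (w : Diagram n m) (s : ℕ), ∀ x : Hom K m n,
      Tr d (comp d (single z) (tensor (idHom K 1) x)) = d ^ s * Tr d (comp d (single w) x) := by
  obtain ⟨w, s, h⟩ := trace_left_closure z
  refine ⟨w, s, fun x => ?_⟩
  induction x using hom_induction with
  | h0 => simp only [tensor_zero, comp_zero, Tr_zero, mul_zero]
  | hadd x y hx hy => simp only [tensor_add, comp_add, Tr_add, hx, hy, mul_add]
  | hs r x =>
    rw [tensor_smul, comp_smul, comp_smul, Tr_smul, Tr_smul, mul_left_comm, idHom_eq_single,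
      tensor_single]
    obtain ⟨N, h1, h2⟩ := exists_Tr_comp_single z (dtensor (idD 1) x)
    obtain ⟨M, h3, h4⟩ := exists_Tr_comp_single w x
    rw [h2, h4, ← pow_add, Nat.pow_right_injective le_rfl (a₁ := N) (a₂ := s + M)]
    simp only
    rw [← h1, h, h3, pow_add]

theorem idHom_one_tensor_mem_Negl {d : K} {m n : ℕ} {x : Hom K m n} (hx : x ∈ Negl d m n) :
    tensor (idHom K 1) x ∈ Negl d (1 + m) (1 + n) := by
  intro b
  induction b using hom_induction with
  | h0 => rw [zero_comp, Tr_zero]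
  | hadd a b ha hb => rw [add_comp, Tr_add, ha, hb, add_zero]
  | hs r z =>
    obtain ⟨w, s, h⟩ := exists_Tr_comp_idHom_tensor d z
    rw [smul_comp, Tr_smul, h, hx, mul_zero, mul_zero]

theorem castHom_mem_Negl {d : K} {m n m' n' : ℕ} (hm : m = m') (hn : n = n') {x : Hom K m n} :
    castHom hm hn x ∈ Negl d m' n' ↔ x ∈ Negl d m n := by
  subst hm hn; rfl

theorem zero_idHom_tensor {m n : ℕ} (x : Hom K m n) :
    castHom (Nat.zero_add m) (Nat.zero_add n) (tensor (idHom K 0) x) = x := by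
  induction x using hom_induction with
  | h0 => rw [tensor_zero, castHom_zero]
  | hadd x y hx hy => rw [tensor_add, castHom_add, hx, hy]
  | hs r a =>
    rw [tensor_smul, castHom_smul, idHom_eq_single, tensor_single, castHom_single]
    congr 2
    refine Diagram.ext_compat fun F hF => ?_
    obtain ⟨f, g, rfl⟩ : ∃ f h, F = Sum.elim f h := ⟨_, _, (Sum.elim_comp_inl_inr F).symm⟩
    rw [compat_castDiagram, compat_dtensor] at hF
    convert hF.2 using 4 <;> exact Fin.ext (by simp)

theorem idHom_tensor_mem_Negl {d : K} (k : ℕ) {m n : ℕ} {x : Hom K m n} (hx : x ∈ Negl d m n) :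
    tensor (idHom K k) x ∈ Negl d (k + m) (k + n) := by
  induction k generalizing m n with
  | zero => rwa [← castHom_mem_Negl (Nat.zero_add m) (Nat.zero_add n), zero_idHom_tensor]
  | succ k ih =>
    have h := ih (idHom_one_tensor_mem_Negl hx)
    rwa [← tensor_idHom_succ, castHom_mem_Negl] at h

/-- Negligible morphisms form an ideal. -/
theorem isIdeal_Negl (d : K) : IsIdeal d (fun m n => Negl d m n) where
  zero_mem m n b := by rw [comp_zero, Tr_zero]
  add_mem m n x hx y hy b := by rw [comp_add, Tr_add, hx, hy, add_zero]
  smul_mem m n c x hx b := by rw [comp_smul, Tr_smul, hx, mul_zero]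
  comp_mem_left b a ha c := by rw [comp_assoc]; exact ha _
  comp_mem_right b a hb c := by
    rw [Tr_comp_comm, ← comp_assoc, Tr_comp_comm]
    exact hb _
  tensor_mem_left {m n m' n'} x y hx b := by
    rw [← id_comp (d := d) x, ← comp_id (d := d) y, tensor_comp, comp_assoc]
    exact tensor_idHom_mem_Negl hx _ _
  tensor_mem_right {m n m' n'} x y hy b := by
    rw [← id_comp (d := d) y, ← comp_id (d := d) x, tensor_comp, comp_assoc]
    exact idHom_tensor_mem_Negl _ hy _

/-! ### The shape of diagrams -/

/-- Two adjacent top points are joined. -/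
def HasCup {m n : ℕ} (b : Diagram m n) : Prop :=
  ∃ (i : ℕ) (h : i + 2 ≤ m), b.pair (Sum.inl ⟨i, by omega⟩) = Sum.inl ⟨i + 1, h⟩

/-- Two adjacent bottom points are joined. -/
def HasCap {m n : ℕ} (b : Diagram m n) : Prop :=
  ∃ (i : ℕ) (h : i + 2 ≤ n), b.pair (Sum.inr ⟨i, by omega⟩) = Sum.inr ⟨i + 1, h⟩

theorem hasCup_of_pair {m n : ℕ} (b : Diagram m n) (i j : Fin m) (hij : i < j)
    (h : b.pair (Sum.inl i) = Sum.inl j) : HasCup b := by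
  induction hs : (j : ℕ) - i using Nat.strong_induction_on generalizing i j with
  | _ s ih =>
  obtain ⟨i, hi⟩ := i
  obtain ⟨j, hj⟩ := j
  simp only [Fin.mk_lt_mk] at hij hs
  by_cases h1 : j = i + 1
  · subst h1; exact ⟨i, hj, h⟩
  have h2 : i + 1 < m := by omega
  have c1 := b.noncrossing (Sum.inl ⟨i, hi⟩) (Sum.inl ⟨i + 1, h2⟩)
  have c2 := b.noncrossing (b.pair (Sum.inl ⟨i + 1, h2⟩)) (Sum.inl ⟨i, hi⟩)
  have f := b.fixedPointFree (Sum.inl ⟨i + 1, h2⟩)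
  have ni : b.pair (Sum.inl ⟨i + 1, h2⟩) ≠ Sum.inl ⟨i, hi⟩ := fun e => by
    rw [← e, b.involutive] at h
    simp at h; omega
  have nj : b.pair (Sum.inl ⟨i + 1, h2⟩) ≠ Sum.inl ⟨j, hj⟩ := fun e => by
    rw [← h] at e
    have := b.involutive.injective e
    simp at this
  rw [b.involutive] at c2
  rw [h] at c1 c2
  rcases hk : b.pair (Sum.inl ⟨i + 1, h2⟩) with ⟨k, hk'⟩ | ⟨k, hk'⟩
  · rw [hk] at c1 c2 f ni nj
    simp only [bIdx, ne_eq, Sum.inl.injEq, Fin.mk.injEq] at c1 c2 f ni nj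
    exact ih (k - (i + 1)) (by omega) ⟨i + 1, h2⟩ ⟨k, hk'⟩ (by simp; omega) hk rfl
  · rw [hk] at c1
    simp only [bIdx] at c1
    omega

theorem hasCap_of_pair {m n : ℕ} (b : Diagram m n) (i j : Fin n) (hij : i < j)
    (h : b.pair (Sum.inr i) = Sum.inr j) : HasCap b := by
  induction hs : (j : ℕ) - i using Nat.strong_induction_on generalizing i j with
  | _ s ih =>
  obtain ⟨i, hi⟩ := i
  obtain ⟨j, hj⟩ := j
  simp only [Fin.mk_lt_mk] at hij hs
  by_cases h1 : j = i + 1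
  · subst h1; exact ⟨i, hj, h⟩
  have h2 : i + 1 < n := by omega
  have c1 := b.noncrossing (Sum.inr ⟨j, hj⟩) (Sum.inr ⟨i + 1, h2⟩)
  have c2 := b.noncrossing (b.pair (Sum.inr ⟨i + 1, h2⟩)) (Sum.inr ⟨j, hj⟩)
  have f := b.fixedPointFree (Sum.inr ⟨i + 1, h2⟩)
  have h' : b.pair (Sum.inr ⟨j, hj⟩) = Sum.inr ⟨i, hi⟩ := by rw [← h, b.involutive]
  have ni : b.pair (Sum.inr ⟨i + 1, h2⟩) ≠ Sum.inr ⟨i, hi⟩ := fun e => by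
    rw [← e, b.involutive] at h
    simp at h; omega
  have nj : b.pair (Sum.inr ⟨i + 1, h2⟩) ≠ Sum.inr ⟨j, hj⟩ := fun e => by
    rw [← h] at e
    have := b.involutive.injective e
    simp at this
  rw [b.involutive] at c2
  rw [h'] at c1 c2
  rcases hk : b.pair (Sum.inr ⟨i + 1, h2⟩) with ⟨k, hk'⟩ | ⟨k, hk'⟩
  · rw [hk] at c1 c2
    simp only [bIdx] at c1 c2
    omega
  · rw [hk] at c1 c2 f ni nj
    simp only [bIdx, ne_eq, Sum.inr.injEq, Fin.mk.injEq] at c1 c2 f ni nj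
    exact ih (k - (i + 1)) (by omega) ⟨i + 1, h2⟩ ⟨k, hk'⟩ (by simp; omega) hk rfl

theorem exists_through_of_not_hasCup {m n : ℕ} {b : Diagram m n} (hb : ¬ HasCup b) :
    ∃ φ : Fin m → Fin n, StrictMono φ ∧ ∀ i, b.pair (Sum.inl i) = Sum.inr (φ i) := by
  have h : ∀ i, ∃ j, b.pair (Sum.inl i) = Sum.inr j := by
    intro i
    rcases hk : b.pair (Sum.inl i) with k | k
    · rcases lt_trichotomy i k with h | h | h
      · exact (hb (hasCup_of_pair b i k h hk)).elim
      · rw [h] at hk; exact (b.fixedPointFree _ hk).elim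
      · exact (hb (hasCup_of_pair b k i h (by rw [← hk, b.involutive]))).elim
    · exact ⟨k, rfl⟩
  choose φ hφ using h
  refine ⟨φ, fun i j hij => ?_, hφ⟩
  have c := b.noncrossing (Sum.inl i) (Sum.inl j)
  have e : φ i ≠ φ j := fun e => by
    have := b.involutive.injective ((hφ i).trans ((congrArg _ e).trans (hφ j).symm))
    exact hij.ne (Sum.inl_injective this)
  rw [hφ, hφ] at c
  simp only [bIdx] at c
  rw [Fin.lt_def] at hij ⊢
  have := Fin.val_ne_of_ne e
  omega

theorem exists_through_of_not_hasCap {m n : ℕ} {b : Diagram m n} (hb : ¬ HasCap b) :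
    ∃ φ : Fin n → Fin m, StrictMono φ ∧ ∀ i, b.pair (Sum.inr i) = Sum.inl (φ i) := by
  have h : ∀ i, ∃ j, b.pair (Sum.inr i) = Sum.inl j := by
    intro i
    rcases hk : b.pair (Sum.inr i) with k | k
    · exact ⟨k, rfl⟩
    · rcases lt_trichotomy i k with h | h | h
      · exact (hb (hasCap_of_pair b i k h hk)).elim
      · rw [h] at hk; exact (b.fixedPointFree _ hk).elim
      · exact (hb (hasCap_of_pair b k i h (by rw [← hk, b.involutive]))).elim
  choose φ hφ using h
  refine ⟨φ, fun i j hij => ?_, hφ⟩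
  have c := b.noncrossing (Sum.inl (φ i)) (Sum.inl (φ j))
  have c' := b.noncrossing (Sum.inl (φ j)) (Sum.inl (φ i))
  have e : φ i ≠ φ j := fun e => by
    have := b.involutive.injective ((hφ i).trans ((congrArg _ e).trans (hφ j).symm))
    exact hij.ne (Sum.inr_injective this)
  rw [← hφ, ← hφ, b.involutive, b.involutive, hφ, hφ] at c c'
  simp only [bIdx] at c c'
  rw [Fin.lt_def] at hij ⊢
  have := Fin.val_ne_of_ne e
  omega

theorem Diagram.hasCup_of_lt {m n : ℕ} (b : Diagram m n) (h : n < m) : HasCup b := by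
  by_contra hb
  obtain ⟨φ, hφ, -⟩ := exists_through_of_not_hasCup hb
  have := Fintype.card_le_of_injective φ hφ.injective
  simp only [Fintype.card_fin] at this
  omega

theorem Diagram.hasCap_of_lt {m n : ℕ} (b : Diagram m n) (h : m < n) : HasCap b := by
  by_contra hb
  obtain ⟨φ, hφ, -⟩ := exists_through_of_not_hasCap hb
  have := Fintype.card_le_of_injective φ hφ.injective
  simp only [Fintype.card_fin] at this
  omega

theorem strictMono_fin_eq_id {n : ℕ} {φ : Fin n → Fin n} (h : StrictMono φ) : φ = id := by
  have := Subsingleton.elim (h.orderIsoOfSurjective φ (Finite.surjective_of_injective h.injective))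
    (OrderIso.refl _)
  exact congrArg (fun e : Fin n ≃o Fin n => (e : Fin n → Fin n)) this

theorem Diagram.hasCup_of_ne {n : ℕ} {b : Diagram n n} (h : b ≠ idD n) : HasCup b := by
  by_contra hb
  obtain ⟨φ, hφ, hφ'⟩ := exists_through_of_not_hasCup hb
  rw [strictMono_fin_eq_id hφ] at hφ'
  refine h (Diagram.ext_pair (funext fun x => ?_))
  rcases x with x | x
  · exact hφ' x
  · exact (congrArg b.pair (hφ' x)).symm.trans (b.involutive _)

theorem Diagram.hasCap_of_ne {n : ℕ} {b : Diagram n n} (h : b ≠ idD n) : HasCap b := by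
  by_contra hb
  obtain ⟨φ, hφ, hφ'⟩ := exists_through_of_not_hasCap hb
  rw [strictMono_fin_eq_id hφ] at hφ'
  refine h (Diagram.ext_pair (funext fun x => ?_))
  rcases x with x | x
  · exact (congrArg b.pair (hφ' x)).symm.trans (b.involutive _)
  · exact hφ' x

theorem dcomp_ne_idD {m n : ℕ} (h : m < n) (b : Diagram m n) (a : Diagram n m) :
    dcomp b a ≠ idD n := by
  obtain ⟨i, hi, ha⟩ := a.hasCup_of_lt h
  intro e
  have h1 : Compat (dcomp b a) (Sum.elim (Pi.single ⟨i, by omega⟩ 1) (Pi.single ⟨i, by omega⟩ 1)) := by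
    rw [e, compat_idD]
  obtain ⟨g, h2, -⟩ := compat_dcomp.1 h1
  have := h2 (Sum.inl ⟨i, by omega⟩)
  rw [ha] at this
  simp at this

/-- Morphisms factoring through fewer points have no identity component. -/
theorem comp_apply_idD {d : K} {m n : ℕ} (h : m < n) (b : Hom K m n) (a : Hom K n m) :
    comp d b a (idD n) = 0 := by
  induction a using hom_induction with
  | h0 => rw [comp_zero]; rfl
  | hadd x y hx hy => rw [comp_add, Pi.add_apply, hx, hy, add_zero]
  | hs r a =>
  induction b using hom_induction with
  | h0 => rw [zero_comp]; rfl
  | hadd x y hx hy => rw [add_comp, Pi.add_apply, hx, hy, add_zero]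
  | hs s b =>
    rw [comp_smul, smul_comp, comp_single]
    simp [single, (dcomp_ne_idD h b a).symm]

theorem addStrand_apply_idD {n : ℕ} (a : Hom K n n) : addStrand a (idD (n + 1)) = a (idD n) := by
  unfold addStrand
  induction a using hom_induction with
  | h0 => rw [zero_tensor]; rfl
  | hadd x y hx hy => rw [add_tensor, Pi.add_apply, hx, hy, Pi.add_apply]
  | hs r a =>
    rw [smul_tensor, idHom_eq_single, tensor_single, Pi.smul_apply, Pi.smul_apply]
    congr 1
    refine if_congr ⟨fun h => Eq.symm ?_, fun h => ?_⟩ rfl rfl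
    · refine Diagram.ext_compat fun F hF => ?_
      obtain ⟨f, g, rfl⟩ : ∃ f h, F = Sum.elim f h := ⟨_, _, (Sum.elim_comp_inl_inr F).symm⟩
      have h1 : Compat (dtensor a (idD 1)) (Sum.elim (Fin.append f 0) (Fin.append g 0)) := by
        rw [compat_dtensor]
        simp only [Fin.append_left, Fin.append_right]
        exact ⟨hF, compat_idD.2 rfl⟩
      rw [← h, compat_idD] at h1
      rw [compat_idD]
      funext i
      simpa using congrFun h1 (Fin.castAdd 1 i)
    · rw [← h]; exact (dtensor_idD n 1).symm

/-! ### Morphisms killed by all `E_i` -/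

/-- `p` is killed on both sides by all `E_i`, and these suffice to kill everything else. -/
structure Killed (d : K) {n : ℕ} (p : Hom K n n) : Prop where
  ne_zero : 2 ≤ n → d ≠ 0
  left : ∀ i, i + 2 ≤ n → comp d (EHom K n i) p = 0
  right : ∀ i, i + 2 ≤ n → comp d p (EHom K n i) = 0

section Killed

variable {d : K} {n : ℕ} {p : Hom K n n}

theorem Killed.single_comp (hp : Killed d p) {m : ℕ} {b : Diagram n m} (hb : HasCup b) :
    comp d (single b) p = 0 := by
  obtain ⟨i, h, hb⟩ := hb
  have e := comp_assoc (d := d) (single b) (EHom K n i) p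
  rw [hp.left i h, comp_zero, comp_EHom_of_cup d h hb, smul_comp] at e
  exact (smul_eq_zero.1 e.symm).resolve_left (hp.ne_zero (by omega))

theorem Killed.comp_single (hp : Killed d p) {m : ℕ} {b : Diagram m n} (hb : HasCap b) :
    comp d p (single b) = 0 := by
  obtain ⟨i, h, hb⟩ := hb
  have e := comp_assoc (d := d) p (EHom K n i) (single b)
  rw [hp.right i h, zero_comp, EHom_comp_of_cap d h hb, comp_smul] at e
  exact (smul_eq_zero.1 e).resolve_left (hp.ne_zero (by omega))

theorem Killed.comp_of_lt (hp : Killed d p) {m : ℕ} (h : m < n) (b : Hom K n m) :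
    comp d b p = 0 := by
  induction b using hom_induction with
  | h0 => exact zero_comp _
  | hadd x y hx hy => rw [add_comp, hx, hy, add_zero]
  | hs r b => rw [smul_comp, hp.single_comp (b.hasCup_of_lt h), smul_zero]

theorem Killed.comp_of_gt (hp : Killed d p) {m : ℕ} (h : m < n) (b : Hom K m n) :
    comp d p b = 0 := by
  induction b using hom_induction with
  | h0 => exact comp_zero _
  | hadd x y hx hy => rw [comp_add, hx, hy, add_zero]
  | hs r b => rw [comp_smul, hp.comp_single (b.hasCap_of_lt h), smul_zero]

theorem Killed.comp_left (hp : Killed d p) (b : Hom K n n) : comp d b p = b (idD n) • p := by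
  induction b using hom_induction with
  | h0 => rw [zero_comp]; simp
  | hadd x y hx hy => rw [add_comp, hx, hy, Pi.add_apply, add_smul]
  | hs r b =>
    rw [smul_comp, Pi.smul_apply, smul_assoc]
    congr 1
    by_cases hb : b = idD n
    · rw [hb, ← idHom_eq_single, id_comp]; simp [idHom]
    · rw [hp.single_comp (Diagram.hasCup_of_ne hb)]; simp [single, Ne.symm hb]

theorem Killed.comp_right (hp : Killed d p) (b : Hom K n n) : comp d p b = b (idD n) • p := by
  induction b using hom_induction with
  | h0 => rw [comp_zero]; simp
  | hadd x y hx hy => rw [comp_add, hx, hy, Pi.add_apply, add_smul]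
  | hs r b =>
    rw [comp_smul, Pi.smul_apply, smul_assoc]
    congr 1
    by_cases hb : b = idD n
    · rw [hb, ← idHom_eq_single, comp_id]; simp [idHom]
    · rw [hp.comp_single (Diagram.hasCap_of_ne hb)]; simp [single, Ne.symm hb]

end Killed

/-! ### The Jones–Wenzl recursion -/

/-- The Wenzl projections, defined by the Jones–Wenzl recursion. -/
noncomputable def jw (d : K) : (n : ℕ) → Hom K n n
  | 0 => idHom K 0
  | 1 => idHom K 1
  | n + 2 => addStrand (jw d (n + 1)) - (qInt d (n + 1) / qInt d (n + 2)) •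
      comp d (addStrand (jw d (n + 1))) (comp d (capR K n) (comp d (cupR K n)
        (addStrand (jw d (n + 1)))))

/-- `p` is killed by all `E_i` and has coefficient one at the identity. -/
structure IsWenzl (d : K) {n : ℕ} (p : Hom K n n) : Prop extends Killed d p where
  apply_idD : p (idD n) = 1

theorem idHom_apply_idD (n : ℕ) : idHom K n (idD n) = 1 := by simp [idHom]

theorem isWenzl_jw_zero (d : K) : IsWenzl d (jw d 0) where
  ne_zero h := absurd h (by omega)
  left i h := absurd h (by omega)
  right i h := absurd h (by omega)
  apply_idD := idHom_apply_idD 0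

theorem isWenzl_jw_one (d : K) : IsWenzl d (jw d 1) where
  ne_zero h := absurd h (by omega)
  left i h := absurd h (by omega)
  right i h := absurd h (by omega)
  apply_idD := idHom_apply_idD 1

theorem IsWenzl.comp_addStrand {d : K} {n : ℕ} {P : Hom K (n + 1) (n + 1)} {Q : Hom K n n}
    (hP : IsWenzl d P) (hQ : IsWenzl d Q) : comp d P (addStrand Q) = P := by
  rw [hP.comp_right, addStrand_apply_idD, hQ.apply_idD, one_smul]

theorem IsWenzl.addStrand_comp {d : K} {n : ℕ} {P : Hom K (n + 1) (n + 1)} {Q : Hom K n n}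
    (hP : IsWenzl d P) (hQ : IsWenzl d Q) : comp d (addStrand Q) P = P := by
  rw [hP.comp_left, addStrand_apply_idD, hQ.apply_idD, one_smul]

theorem IsWenzl.comp_self {d : K} {n : ℕ} {P : Hom K n n} (hP : IsWenzl d P) :
    comp d P P = P := by
  rw [hP.comp_left, hP.apply_idD, one_smul]

section Step

variable {d : K} {n : ℕ} {P : Hom K (n + 1) (n + 1)} {Q : Hom K n n}

theorem comp_cupR_addStrand (hP : IsWenzl d P) (hQ : IsWenzl d Q) :
    comp d Q (comp d (cupR K n) (addStrand P)) = comp d (cupR K n) (addStrand P) := by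
  rw [comp_assoc, ← cupR_comp_addStrand_addStrand, ← comp_assoc, ← TL.addStrand_comp,
    hP.addStrand_comp hQ]

theorem addStrand_capR_comp (hP : IsWenzl d P) (hQ : IsWenzl d Q) :
    comp d (comp d (addStrand P) (capR K n)) Q = comp d (addStrand P) (capR K n) := by
  rw [← comp_assoc, ← addStrand_addStrand_comp_capR, comp_assoc, ← TL.addStrand_comp,
    hP.comp_addStrand hQ]

theorem isWenzl_step (hP : IsWenzl d P) (hQ : IsWenzl d Q) (hd : d ≠ 0) {a b : K} (ha : a ≠ 0)
    (hb : b ≠ 0)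
    (h : comp d (cupR K n) (comp d (addStrand P) (capR K n)) = (b / a) • Q) :
    IsWenzl d (addStrand P - (a / b) •
      comp d (addStrand P) (comp d (capR K n) (comp d (cupR K n) (addStrand P)))) := by
  have hab : a / b * (b / a) = 1 := by field_simp
  refine ⟨⟨fun _ => hd, fun i hi => ?_, fun i hi => ?_⟩, ?_⟩
  · by_cases hi' : i + 2 ≤ n + 1
    · have e : comp d (EHom K (n + 2) i) (addStrand P) = 0 := by
        rw [← addStrand_EHom hi', ← addStrand_comp, hP.left i hi']
        exact zero_tensor _
      rw [comp_sub, comp_smul, comp_assoc, e, zero_comp, smul_zero, sub_zero]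
    · obtain rfl : i = n := by omega
      rw [EHom_last d, ← comp_assoc]
      convert comp_zero _
      rw [comp_sub, comp_smul, comp_assoc (addStrand P), comp_assoc (cupR K i), h, smul_comp,
        comp_cupR_addStrand hP hQ, smul_smul, hab, one_smul, sub_self]
  · by_cases hi' : i + 2 ≤ n + 1
    · have e : comp d (addStrand P) (EHom K (n + 2) i) = 0 := by
        rw [← addStrand_EHom hi', ← addStrand_comp, hP.right i hi']
        exact zero_tensor _
      rw [sub_comp, smul_comp, ← comp_assoc, ← comp_assoc, ← comp_assoc, e, comp_zero, comp_zero,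
        comp_zero, smul_zero, sub_zero]
    · obtain rfl : i = n := by omega
      rw [EHom_last d, comp_assoc]
      convert zero_comp _
      rw [sub_comp, smul_comp, comp_assoc (addStrand P), ← comp_assoc _ _ (capR K i),
        ← comp_assoc _ _ (capR K i), h, comp_smul, addStrand_capR_comp hP hQ, smul_smul, hab,
        one_smul, sub_self]
  · rw [Pi.sub_apply, Pi.smul_apply, comp_assoc, comp_apply_idD (by omega), smul_zero, sub_zero,
      addStrand_apply_idD, hP.apply_idD]

theorem partialTrace_step (hP : IsWenzl d P) {a b : K} (hb : b ≠ 0) :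
    comp d (cupR K (n + 1)) (comp d (addStrand (addStrand P - (a / b) •
      comp d (addStrand P) (comp d (capR K n) (comp d (cupR K n) (addStrand P)))))
        (capR K (n + 1))) = ((d * b - a) / b) • P := by
  have e1 : comp d (cupR K (n + 1)) (comp d (addStrand (addStrand P)) (capR K (n + 1)))
      = d • P := by
    rw [addStrand_addStrand_comp_capR, comp_assoc, cupR_comp_capR, smul_comp, id_comp]
  have e2 : comp d (cupR K (n + 1)) (comp d (addStrand (comp d (addStrand P) (comp d (capR K n)
      (comp d (cupR K n) (addStrand P))))) (capR K (n + 1))) = P := by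
    rw [addStrand_comp, addStrand_comp, addStrand_comp, ← comp_assoc, ← comp_assoc, ← comp_assoc,
      addStrand_addStrand_comp_capR, comp_assoc (addStrand (cupR K n)),
      addStrand_cupR_comp_capR, id_comp, comp_assoc, cupR_comp_addStrand_addStrand,
      ← comp_assoc, comp_assoc _ _ P, cupR_comp_addStrand_capR, id_comp, hP.comp_self]
  have e3 : ∀ x y : Hom K (n + 2) (n + 2), ∀ c : K,
      addStrand (x - c • y) = addStrand x - c • addStrand y := fun x y c => by
    unfold addStrand
    rw [sub_eq_add_neg, ← neg_smul, add_tensor, smul_tensor, neg_smul, ← sub_eq_add_neg]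
  rw [e3, sub_comp, comp_sub, smul_comp, comp_smul, e1, e2, ← sub_smul]
  congr 1
  field_simp

end Step

theorem jw_succ_aux (d : K) (n : ℕ) (h : ∀ j, 1 ≤ j → j ≤ n + 1 → qInt d j ≠ 0) :
    IsWenzl d (jw d n) ∧ IsWenzl d (jw d (n + 1)) ∧
      comp d (cupR K n) (comp d (addStrand (jw d (n + 1))) (capR K n)) =
        (qInt d (n + 2) / qInt d (n + 1)) • jw d n := by
  induction n with
  | zero =>
    refine ⟨isWenzl_jw_zero d, isWenzl_jw_one d, ?_⟩
    have e : addStrand (jw d 1) = idHom K 2 := addStrand_idHom 1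
    rw [e, id_comp, cupR_comp_capR]
    simp [qInt, jw]
  | succ n ih =>
    obtain ⟨h0, h1, h2⟩ := ih fun j hj hj' => h j hj (by omega)
    have hd : d ≠ 0 := by simpa [qInt] using h 2 (by omega) (by omega)
    have hb := h (n + 2) (by omega) (by omega)
    exact ⟨h1, isWenzl_step h1 h0 hd (h (n + 1) (by omega) (by omega)) hb h2,
      partialTrace_step h1 hb⟩

theorem isWenzl_jw {d : K} {n : ℕ} (h : ∀ j, 1 ≤ j → j ≤ n → qInt d j ≠ 0) :
    IsWenzl d (jw d n) := by
  cases n with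
  | zero => exact isWenzl_jw_zero d
  | succ n => exact (jw_succ_aux d n h).2.1

theorem Tr_idHom_zero (d : K) : Tr d (idHom K 0) = 1 := by
  have h : (2 : ℕ) ^ trLoops (idD 0) = 1 := by
    rw [← trace_mat, mat_idD, Matrix.trace_one]
    rfl
  have h' : trLoops (idD 0) = 0 := by simpa using h
  rw [idHom_eq_single, Tr_single, h', pow_zero]

theorem Tr_jw {d : K} {n : ℕ} (h : ∀ j, 1 ≤ j → j ≤ n → qInt d j ≠ 0) :
    Tr d (jw d n) = qInt d (n + 1) := by
  induction n with
  | zero => exact Tr_idHom_zero d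
  | succ n ih =>
    rw [← Tr_close_last, (jw_succ_aux d n h).2.2, Tr_smul,
      ih fun j hj hj' => h j hj (by omega), div_mul_cancel₀ _ (h _ (by omega) le_rfl)]

/-! ### Negligible morphisms -/

/-- Endomorphisms of `n` generated by `J` and by the morphisms factoring through one of the Wenzl
projections on at most `t` strands. -/
inductive ThroughWenzl (d : K) (J : ∀ m n : ℕ, Set (Hom K m n)) (t n : ℕ) : Hom K n n → Prop
  | of_mem (x : Hom K n n) (hx : x ∈ J n n) : ThroughWenzl d J t n x
  | jw (k : ℕ) (hk : k ≤ t) (a : Hom K k n) (b : Hom K n k) :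
      ThroughWenzl d J t n (comp d a (comp d (jw d k) b))
  | add (x y : Hom K n n) (hx : ThroughWenzl d J t n x) (hy : ThroughWenzl d J t n y) :
      ThroughWenzl d J t n (x + y)

section Ideal

variable {d : K} {J : ∀ m n : ℕ, Set (Hom K m n)} {t : ℕ}

theorem ThroughWenzl.of_jw_le (hJ : IsIdeal d J) (hp : TL.jw d (t + 1) ∈ J (t + 1) (t + 1)) {n k : ℕ}
    (hk : k ≤ t + 1) (a : Hom K k n) (b : Hom K n k) :
    ThroughWenzl d J t n (comp d a (comp d (TL.jw d k) b)) := by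
  obtain hk | rfl := Nat.le_succ_iff.1 hk
  · exact .jw k hk a b
  · exact .of_mem _ (hJ.comp_mem_left _ _ (hJ.comp_mem_right _ _ hp))

theorem ThroughWenzl.addStrand (hJ : IsIdeal d J) (hp : TL.jw d (t + 1) ∈ J (t + 1) (t + 1))
    (h : ∀ j, 1 ≤ j → j ≤ t + 1 → qInt d j ≠ 0) {n : ℕ} {x : Hom K n n}
    (hx : ThroughWenzl d J t n x) : ThroughWenzl d J t (n + 1) (TL.addStrand x) := by
  induction hx with
  | of_mem x hx => exact .of_mem _ (hJ.tensor_mem_left _ _ hx)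
  | add x y _ _ ihx ihy =>
    unfold TL.addStrand
    rw [add_tensor]
    exact .add _ _ ihx ihy
  | jw k hk a b =>
    rw [addStrand_comp, addStrand_comp]
    obtain _ | k := k
    · have e : TL.addStrand (TL.jw d 0) = TL.jw d 1 := addStrand_idHom 0
      rw [e]
      exact of_jw_le hJ hp (by omega) _ _
    · have e : TL.addStrand (TL.jw d (k + 1)) = TL.jw d (k + 2) +
          (qInt d (k + 1) / qInt d (k + 2)) • comp d (TL.addStrand (TL.jw d (k + 1)))
            (comp d (capR K k) (comp d (cupR K k) (TL.addStrand (TL.jw d (k + 1))))) := by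
        rw [TL.jw, sub_add_cancel]
      rw [e, add_comp, comp_add]
      refine .add _ _ (of_jw_le hJ hp (by omega) _ _) ?_
      obtain ⟨h0, h1, -⟩ := jw_succ_aux d k fun j hj hj' => h j hj (by omega)
      rw [← comp_cupR_addStrand h1 h0, smul_comp, comp_smul, ← smul_comp]
      simp only [← comp_assoc]
      rw [comp_assoc (TL.addStrand (TL.jw d (k + 1))), comp_assoc (_ • TL.addStrand a)]
      exact of_jw_le hJ hp (by omega) _ _

theorem throughWenzl_idHom (hJ : IsIdeal d J) (hp : jw d (t + 1) ∈ J (t + 1) (t + 1))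
    (h : ∀ j, 1 ≤ j → j ≤ t + 1 → qInt d j ≠ 0) (n : ℕ) :
    ThroughWenzl d J t n (idHom K n) := by
  induction n with
  | zero =>
    have := ThroughWenzl.jw (d := d) (J := J) (t := t) (n := 0) 0 (by omega)
      (idHom K 0) (idHom K 0)
    rwa [comp_id, id_comp] at this
  | succ n ih =>
    rw [← addStrand_idHom]
    exact ih.addStrand hJ hp h

theorem jw_comp_comp_jw (h : ∀ j, 1 ≤ j → j ≤ t + 1 → qInt d j ≠ 0) {j k : ℕ} (hj : j ≤ t)
    (hk : k ≤ t) {w : Hom K k j} (hw : w ∈ Negl d k j) :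
    comp d (jw d j) (comp d w (jw d k)) = 0 := by
  have hwj := isWenzl_jw fun i hi hi' => h i hi (by omega : i ≤ t + 1)
  have hj' : IsWenzl d (jw d j) := isWenzl_jw fun i hi hi' => h i hi (by omega)
  have hk' : IsWenzl d (jw d k) := isWenzl_jw fun i hi hi' => h i hi (by omega)
  rcases lt_trichotomy j k with hlt | rfl | hlt
  · rw [hk'.comp_of_lt hlt, comp_zero]
  · have e := hw (jw d j)
    rw [hj'.comp_right, Tr_smul, Tr_jw fun i hi hi' => h i hi (by omega)] at e
    rw [hj'.comp_left, (mul_eq_zero.1 e).resolve_right (h _ (by omega) (by omega)), zero_smul,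
      comp_zero]
  · rw [comp_assoc, hj'.comp_of_gt hlt, zero_comp]

theorem mem_of_mem_Negl (hJ : IsIdeal d J) (hp : jw d (t + 1) ∈ J (t + 1) (t + 1))
    (h : ∀ j, 1 ≤ j → j ≤ t + 1 → qInt d j ≠ 0) {m n : ℕ} {x : Hom K m n}
    (hx : x ∈ Negl d m n) : x ∈ J m n := by
  have hN := isIdeal_Negl d
  have key : ∀ k ≤ t, ∀ z ∈ Negl d k n, comp d z (jw d k) ∈ J k n := by
    intro k hk z hz
    rw [← id_comp (d := d) (comp d z (jw d k))]
    generalize idHom K n = y, throughWenzl_idHom hJ hp h n = hy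
    induction hy with
    | of_mem y hy => exact hJ.comp_mem_right _ _ hy
    | add y y' _ _ ih ih' => rw [add_comp]; exact hJ.add_mem _ _ _ ih _ ih'
    | jw j hj a b =>
      rw [← comp_assoc, ← comp_assoc, comp_assoc b,
        jw_comp_comp_jw h hj hk (hN.comp_mem_left b z hz), comp_zero]
      exact hJ.zero_mem _ _
  rw [← comp_id (d := d) x]
  generalize idHom K m = y, throughWenzl_idHom hJ hp h m = hy
  induction hy with
  | of_mem y hy => exact hJ.comp_mem_left _ _ hy
  | add y y' _ _ ih ih' => rw [comp_add]; exact hJ.add_mem _ _ _ ih _ ih'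
  | jw k hk a b =>
    rw [comp_assoc, comp_assoc]
    exact hJ.comp_mem_right _ _ (key k hk _ (hN.comp_mem_right x a hx))

end Ideal

theorem Negl_eq_genIdeal {d : K} {t : ℕ} (h : ∀ j, 1 ≤ j → j ≤ t + 1 → qInt d j ≠ 0)
    (h0 : qInt d (t + 2) = 0) (m n : ℕ) : Negl d m n = genIdeal d (jw d (t + 1)) m n := by
  refine Set.Subset.antisymm (fun x hx J hJ hp => mem_of_mem_Negl hJ hp h hx)
    fun x hx => hx (fun m n => Negl d m n) (isIdeal_Negl d) fun b => ?_
  rw [(isWenzl_jw h).comp_left, Tr_smul, Tr_jw h, h0, mul_zero]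

theorem isJonesWenzl_jw {d : K} {n : ℕ} (h : ∀ j, 1 ≤ j → j ≤ n → qInt d j ≠ 0) :
    IsJonesWenzl d n (jw d n) := by
  have hp := isWenzl_jw h
  refine ⟨fun e => ?_, hp.comp_self, fun i hi => ⟨hp.left i hi, hp.right i hi⟩⟩
  have := hp.apply_idD
  rw [e] at this
  exact zero_ne_one this

theorem IsWenzl.eq_of_isJonesWenzl {d : K} {n : ℕ} {p q : Hom K n n} (hp : IsWenzl d p)
    (hq : IsJonesWenzl d n q) : q = p := by
  obtain ⟨hq0, hqq, hE⟩ := hq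
  have hk : Killed d q := ⟨hp.ne_zero, fun i hi => (hE i hi).1, fun i hi => (hE i hi).2⟩
  have e : q (idD n) = 1 := by
    rw [hk.comp_left] at hqq
    exact smul_left_injective K hq0 (hqq.trans (one_smul K q).symm)
  have e1 := hk.comp_left p
  rw [hp.comp_right, e, hp.apply_idD, one_smul, one_smul] at e1
  exact e1.symm

theorem qInt_mul {τ : K} (hτ : τ ≠ 0) (k : ℕ) :
    qInt (τ + τ⁻¹) k * (τ - τ⁻¹) = τ ^ k - τ⁻¹ ^ k := by
  induction k using Nat.twoStepInduction with
  | zero => simp [qInt]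
  | one => simp [qInt]
  | more k h1 h2 =>
    rw [qInt, sub_mul, mul_assoc, h1, h2]
    have : τ * τ⁻¹ = 1 := mul_inv_cancel₀ hτ
    linear_combination (τ ^ k - τ⁻¹ ^ k) * this

theorem qInt_eq_zero_iff {τ : K} (hτ : τ ≠ 0) (h : τ ^ 2 ≠ 1) (k : ℕ) :
    qInt (τ + τ⁻¹) k = 0 ↔ (τ ^ 2) ^ k = 1 := by
  have h' : τ - τ⁻¹ ≠ 0 := fun e => h (by
    rw [sub_eq_zero] at e
    rw [sq]
    nth_rw 2 [e]
    exact mul_inv_cancel₀ hτ)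
  rw [← mul_eq_zero_iff_right h', qInt_mul hτ, sub_eq_zero, inv_pow,
    ← mul_eq_one_iff_eq_inv₀ (pow_ne_zero k hτ), ← pow_mul, two_mul, pow_add]

/-- Let `τ ∈ ℂ` be a proper root of unity, with `τ²` a primitive
`ℓ`-th root of unity (`ℓ ≥ 2`).  Then `T_{ℓ−1}(τ)` contains a (unique)
Jones–Wenzl idempotent `p_{ℓ−1}`, and the ideal of negligible morphisms in
`TL(τ)` is equal to the ideal generated by `p_{ℓ−1}`. -/
theorem stmt5 (τ : ℂ) (ℓ : ℕ) (hℓ : 2 ≤ ℓ) (hτ : τ ≠ 0)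
    (hprim : IsPrimitiveRoot (τ ^ 2) ℓ) :
    ∃ p : Hom ℂ (ℓ - 1) (ℓ - 1), IsJonesWenzl (τ + τ⁻¹) (ℓ - 1) p ∧
      (∀ q : Hom ℂ (ℓ - 1) (ℓ - 1), IsJonesWenzl (τ + τ⁻¹) (ℓ - 1) q → q = p) ∧
      (∀ m n : ℕ, Negl (τ + τ⁻¹) m n = genIdeal (τ + τ⁻¹) p m n) := by
  obtain ⟨t, rfl⟩ := Nat.exists_eq_add_of_le' hℓ
  have h2 : τ ^ 2 ≠ 1 := hprim.ne_one (by omega)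
  have h : ∀ j, 1 ≤ j → j ≤ t + 1 → qInt (τ + τ⁻¹) j ≠ 0 := fun j hj hj' e =>
    hprim.pow_ne_one_of_pos_of_lt (by omega) (by omega) ((qInt_eq_zero_iff hτ h2 j).1 e)
  exact ⟨jw _ (t + 1), isJonesWenzl_jw h, fun q hq => (isWenzl_jw h).eq_of_isJonesWenzl hq,
    Negl_eq_genIdeal h ((qInt_eq_zero_iff hτ h2 _).2 hprim.pow_eq_one)⟩

end TL
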